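/- arXiv:1207.6699 — 4 statements merged into one kernel-verified Lean document; each statement's English description precedes it below -/
import Mathlib

section
/- Let X and Y be σ-compact metrizable spaces such that C_p(Y) is the image of C_p(X) under a continuous open mapping. If X is a C-space, then Y is a C-space. -/
/-- `Cp X` is the space `C(X, ℝ)` of continuous real-valued functions on `X`,
topologized as a subspace of the product `X → ℝ`, i.e. with the topology of
pointwise convergence. -/
def Cp (X : Type*) [TopologicalSpace X] : Type _ := {f : X → ℝ // Continuous f}

instance (X : Type*) [TopologicalSpace X] : TopologicalSpace (Cp X) :=
  inferInstanceAs (TopologicalSpace {f : X → ℝ // Continuous f})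

/-- A topological space `Z` is a `C`-space if for every sequence `U i` of open covers
of `Z` there is a sequence `V i` of families of pairwise disjoint open sets such that
each member of `V i` is contained in some member of `U i` and `⋃ i, V i` covers `Z`. -/
def IsCSpace (Z : Type*) [TopologicalSpace Z] : Prop :=
  ∀ U : ℕ → Set (Set Z),
    (∀ i, (∀ s ∈ U i, IsOpen s) ∧ ⋃₀ U i = Set.univ) →
    ∃ V : ℕ → Set (Set Z),
      (∀ i, (∀ s ∈ V i, IsOpen s) ∧ (V i).PairwiseDisjoint id ∧
        ∀ s ∈ V i, ∃ t ∈ U i, s ⊆ t) ∧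
      ⋃₀ (⋃ i, V i) = Set.univ


open Set Filter Topology

namespace CSpaceAux

/-- `Good U V`: each `V i` is a disjoint family of open sets refining `U i`. -/
def Good {ι Z : Type*} [TopologicalSpace Z] (U V : ι → Set (Set Z)) : Prop :=
  ∀ i, (∀ s ∈ V i, IsOpen s) ∧ (V i).PairwiseDisjoint id ∧ ∀ s ∈ V i, ∃ t ∈ U i, s ⊆ t

/-- relative version of property C -/
def CSet {Z : Type*} [TopologicalSpace Z] (A : Set Z) : Prop :=
  ∀ U : ℕ → Set (Set Z), (∀ i, (∀ s ∈ U i, IsOpen s) ∧ A ⊆ ⋃₀ U i) →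
    ∃ V : ℕ → Set (Set Z), Good U V ∧ A ⊆ ⋃₀ ⋃ i, V i

lemma reindex {ι Z : Type*} [TopologicalSpace Z] (e : ℕ ≃ ι) {A : Set Z}
    {U : ℕ → Set (Set Z)}
    (h : ∃ V : ι → Set (Set Z), Good (fun i => U (e.symm i)) V ∧ A ⊆ ⋃₀ ⋃ i, V i) :
    ∃ V : ℕ → Set (Set Z), Good U V ∧ A ⊆ ⋃₀ ⋃ i, V i := by
  obtain ⟨V, hV, hA⟩ := h
  refine ⟨fun i => V (e i), fun i => ?_, ?_⟩
  · have := hV (e i)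
    simpa using this
  · intro a ha
    obtain ⟨s, hs, has⟩ := hA ha
    obtain ⟨i, hi⟩ := mem_iUnion.1 hs
    exact ⟨s, mem_iUnion.2 ⟨e.symm i, by simpa using hi⟩, has⟩

lemma CSet.of_finite {Z : Type*} [TopologicalSpace Z] {A : Set Z} (hA : A.Finite) : CSet A := by
  intro U hU
  rcases A.eq_empty_or_nonempty with rfl | hne
  · exact ⟨fun _ => ∅, fun i => by simp, by simp⟩
  obtain ⟨g, hg⟩ := hA.countable.exists_eq_range hne
  have : ∀ i, ∃ s ∈ U i, g i ∈ s := fun i => (hU i).2 (hg ▸ mem_range_self i)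
  choose s hs hgs using this
  refine ⟨fun i => {s i}, fun i => ⟨?_, by simp, ?_⟩, ?_⟩
  · rintro t rfl; exact (hU i).1 _ (hs i)
  · rintro t rfl; exact ⟨_, hs i, Subset.rfl⟩
  · intro a ha
    rw [hg] at ha
    obtain ⟨i, rfl⟩ := ha
    exact ⟨s i, mem_iUnion.2 ⟨i, rfl⟩, hgs i⟩

lemma CSet.fiber {Z W : Type*} [TopologicalSpace Z] [TopologicalSpace W] [T2Space W]
    {A : Set Z} {B : Set W} (hA : IsCompact A) (hB : CSet B) (f : Z → W) (hf : Continuous f)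
    (hAB : ∀ a ∈ A, f a ∈ B) (hfib : ∀ q, CSet (A ∩ f ⁻¹' {q})) : CSet A := by
  intro U hU
  let e : ℕ ≃ ℕ × ℕ := Nat.pairEquiv.symm
  refine reindex e ?_
  have h1 : ∀ (q : W) (i : ℕ), ∃ V : ℕ → Set (Set Z), Good (fun j => U (e.symm (i, j))) V ∧
      A ∩ f ⁻¹' {q} ⊆ ⋃₀ ⋃ j, V j := fun q i => hfib q _ fun j =>
    ⟨(hU _).1, fun a ha => (hU _).2 ha.1⟩
  choose V hV hcov using h1
  let G : W → ℕ → Set Z := fun q i => ⋃₀ ⋃ j, V q i j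
  have hG : ∀ q i, IsOpen (G q i) := fun q i => isOpen_sUnion (by
    intro s hs
    obtain ⟨j, hj⟩ := mem_iUnion.1 hs
    exact (hV q i j).1 s hj)
  let O : W → ℕ → Set W := fun q i => (f '' (A \ G q i))ᶜ
  have hO : ∀ q i, IsOpen (O q i) := fun q i =>
    (((hA.diff (hG q i)).image hf).isClosed).isOpen_compl
  have hqO : ∀ q i, q ∈ O q i := by
    rintro q i ⟨a, ⟨ha, haG⟩, rfl⟩
    exact haG (hcov _ i ⟨ha, rfl⟩)
  obtain ⟨Q, hQ, hQB⟩ := hB (fun i => range fun q => O q i) (fun i =>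
    ⟨by rintro _ ⟨q, rfl⟩; exact hO q i, fun q _ => ⟨_, ⟨q, rfl⟩, hqO q i⟩⟩)
  have h2 : ∀ i (w : Q i), ∃ q, w.1 ⊆ O q i := by
    intro i w
    obtain ⟨_, ⟨q, rfl⟩, h⟩ := (hQ i).2.2 w.1 w.2
    exact ⟨q, h⟩
  choose c hc using h2
  refine ⟨fun p => {s | ∃ w : Q p.1, ∃ v ∈ V (c p.1 w) p.1 p.2, s = f ⁻¹' w.1 ∩ v}, ?_, ?_⟩
  · rintro ⟨i, j⟩
    refine ⟨?_, ?_, ?_⟩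
    · rintro _ ⟨w, v, hv, rfl⟩
      exact (((hQ i).1 w.1 w.2).preimage hf).inter ((hV _ i j).1 v hv)
    · rintro _ ⟨w, v, hv, rfl⟩ _ ⟨w', v', hv', rfl⟩ hne
      by_cases hw : w = w'
      · subst hw
        have hvv : v ≠ v' := by rintro rfl; exact hne rfl
        have := (hV _ i j).2.1 hv hv' hvv
        exact Disjoint.mono inter_subset_right inter_subset_right this
      · have := (hQ i).2.1 w.2 w'.2 (fun h => hw (Subtype.ext h))
        exact Disjoint.mono inter_subset_left inter_subset_left (Disjoint.preimage f this)
    · rintro _ ⟨w, v, hv, rfl⟩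
      obtain ⟨t, ht, hvt⟩ := (hV _ i j).2.2 v hv
      exact ⟨t, ht, inter_subset_right.trans hvt⟩
  · intro a ha
    obtain ⟨w, hw, haw⟩ := hQB (hAB a ha)
    obtain ⟨i, hi⟩ := mem_iUnion.1 hw
    have h3 : f a ∈ O (c i ⟨w, hi⟩) i := hc i ⟨w, hi⟩ haw
    have h4 : a ∈ G (c i ⟨w, hi⟩) i := by
      by_contra h
      exact h3 ⟨a, ⟨ha, h⟩, rfl⟩
    obtain ⟨v, hv, hav⟩ := h4
    obtain ⟨j, hj⟩ := mem_iUnion.1 hv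
    exact ⟨_, mem_iUnion.2 ⟨(i, j), ⟨w, hi⟩, v, hj, rfl⟩, haw, hav⟩

lemma CSet.of_inj {Z W : Type*} [TopologicalSpace Z] [TopologicalSpace W] [T2Space W]
    {A : Set Z} {B : Set W} (hA : IsCompact A) (hB : CSet B) (f : Z → W) (hf : Continuous f)
    (hAB : ∀ a ∈ A, f a ∈ B) (hinj : InjOn f A) : CSet A := by
  refine CSet.fiber hA hB f hf hAB fun q => CSet.of_finite (Set.Subsingleton.finite ?_)
  rintro a ⟨ha, haq⟩ b ⟨hb, hbq⟩
  exact hinj ha hb (haq.trans hbq.symm)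

lemma CSet.pow {X : Type*} [TopologicalSpace X] [T2Space X] {K : Set X} (hK : IsCompact K)
    (hC : CSet K) (n : ℕ) : CSet {x : Fin n → X | ∀ i, x i ∈ K} := by
  have hcomp : ∀ n, IsCompact {x : Fin n → X | ∀ i, x i ∈ K} := fun n =>
    isCompact_pi_infinite fun _ => hK
  induction n with
  | zero => exact CSet.of_finite (Set.toFinite _)
  | succ n ih =>
    have hf : Continuous (fun (x : Fin (n+1) → X) (i : Fin n) => x i.succ) := by fun_prop
    refine CSet.fiber (hcomp _) ih (fun x i => x i.succ) hf (fun x hx i => hx _) fun q => ?_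
    refine CSet.of_inj ((hcomp _).inter_right (isClosed_singleton.preimage hf)) hC (fun x => x 0)
      (continuous_apply 0) (fun x hx => hx.1 0) ?_
    rintro x ⟨hx, hxq⟩ y ⟨hy, hyq⟩ h
    have h2 := hxq.trans hyq.symm
    funext i
    refine Fin.cases h (fun i => ?_) i
    exact congrFun h2 i

lemma sing {W Y : Type*} [TopologicalSpace W] [PseudoEMetricSpace Y] [T2Space Y]
    {P : Set W} (hP : IsCompact P) (hC : CSet P) (p : W → Y) (hp : Continuous p)
    (U : ℕ → Set (Set Y)) (hU : ∀ i, (∀ s ∈ U i, IsOpen s) ∧ ⋃₀ U i = univ) :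
    ∃ V : ℕ → Set (Set Y), Good U V ∧ {y | ∃! z, z ∈ P ∧ p z = y} ⊆ ⋃₀ ⋃ i, V i := by
  obtain ⟨V, hV, hcov⟩ := hC (fun i => (fun s => p ⁻¹' s) '' U i) (fun i => by
    refine ⟨?_, fun z _ => ?_⟩
    · rintro _ ⟨s, hs, rfl⟩
      exact ((hU i).1 s hs).preimage hp
    · have : p z ∈ ⋃₀ U i := by rw [(hU i).2]; trivial
      obtain ⟨s, hs, hz⟩ := this
      exact ⟨_, ⟨s, hs, rfl⟩, hz⟩)
  have h1 : ∀ i (v : V i), ∃ t ∈ U i, v.1 ⊆ p ⁻¹' t := by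
    intro i v
    obtain ⟨_, ⟨t, ht, rfl⟩, h⟩ := (hV i).2.2 v.1 v.2
    exact ⟨t, ht, h⟩
  choose t ht hvt using h1
  let T : Set Y := p '' P
  -- complement in `T` of the small image of `v`
  let D : Set W → Set Y := fun v => p '' (P \ v)
  have hD : ∀ i, ∀ v ∈ V i, IsClosed (D v) := fun i v hv =>
    ((hP.diff ((hV i).1 v hv)).image hp).isClosed
  let E : Set W → Set Y := fun v => {y | Metric.infEDist y (T \ D v) < Metric.infEDist y (D v)}
  have hE : ∀ v, IsOpen (E v) := fun v =>
    isOpen_lt Metric.continuous_infEDist Metric.continuous_infEDist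
  have hdis : ∀ v w, Disjoint v w → Disjoint (E v) (E w) := by
    intro v w hvw
    rw [Set.disjoint_left]
    intro y hy hy'
    have key : ∀ v w, Disjoint v w → T \ D w ⊆ D v := by
      rintro v w h _ ⟨⟨z, hz, rfl⟩, hn⟩
      refine ⟨z, ⟨hz, fun hzv => hn ⟨z, ⟨hz, fun hzw => ?_⟩, rfl⟩⟩, rfl⟩
      exact Set.disjoint_left.1 h hzv hzw
    have a1 : Metric.infEDist y (D v) ≤ Metric.infEDist y (T \ D w) :=
      Metric.infEDist_anti (key v w hvw)
    have a2 : Metric.infEDist y (D w) ≤ Metric.infEDist y (T \ D v) :=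
      Metric.infEDist_anti (key w v hvw.symm)
    exact absurd (lt_of_lt_of_le (lt_of_le_of_lt a1 hy') a2) (not_lt.2 (le_of_lt hy))
  refine ⟨fun i => {s | ∃ v : V i, s = E v.1 ∩ t i v}, fun i => ⟨?_, ?_, ?_⟩, ?_⟩
  · rintro _ ⟨v, rfl⟩
    exact (hE _).inter ((hU i).1 _ (ht i v))
  · rintro _ ⟨v, rfl⟩ _ ⟨w, rfl⟩ hne
    have hvw : v.1 ≠ w.1 := by
      intro h
      have : v = w := Subtype.ext h
      subst this
      exact hne rfl
    exact Disjoint.mono inter_subset_left inter_subset_left (hdis _ _ ((hV i).2.1 v.2 w.2 hvw))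
  · rintro _ ⟨v, rfl⟩
    exact ⟨_, ht i v, inter_subset_right⟩
  · rintro y ⟨z, ⟨hz, rfl⟩, huniq⟩
    obtain ⟨v, hv, hzv⟩ := hcov hz
    obtain ⟨i, hi⟩ := mem_iUnion.1 hv
    refine ⟨_, mem_iUnion.2 ⟨i, ⟨v, hi⟩, rfl⟩, ?_, hvt i ⟨v, hi⟩ hzv⟩
    have hnD : p z ∉ D v := by
      rintro ⟨z', ⟨hz', hn⟩, he⟩
      have := huniq z' ⟨hz', he⟩
      exact hn (this ▸ hzv)
    have h0 : Metric.infEDist (p z) (T \ D v) = 0 :=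
      Metric.infEDist_zero_of_mem ⟨⟨z, hz, rfl⟩, hnD⟩
    change Metric.infEDist (p z) (T \ D v) < Metric.infEDist (p z) (D v)
    rw [h0, pos_iff_ne_zero]
    intro h
    exact hnD ((Metric.mem_iff_infEDist_zero_of_closed (hD i v hi)).2 h)

section Supp

variable {X Y : Type*} [TopologicalSpace X] [TopologicalSpace Y]

/-- zero function -/
def zero (X : Type*) [TopologicalSpace X] : Cp X := ⟨fun _ => 0, continuous_const⟩

/-- `A` is an `ε`-support for `y`. -/
def Supp (Φ : Cp X → Cp Y) (m : ℕ) (A : Set X) (y : Y) : Prop :=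
  ∀ f : Cp X, (∀ a ∈ A, |f.1 a| < 1 / ((m : ℝ) + 1)) → |(Φ f).1 y - (Φ (zero X)).1 y| ≤ 1

/-- basic neighbourhoods -/
lemma nhds_basic (f : Cp X) (N : Set (Cp X)) (hN : N ∈ 𝓝 f) :
    ∃ F : Set X, F.Finite ∧ ∃ m : ℕ, ∀ g : Cp X,
      (∀ a ∈ F, |g.1 a - f.1 a| < 1 / ((m : ℝ) + 1)) → g ∈ N := by
  have h1 : 𝓝 f = comap (fun g : Cp X => g.1) (𝓝 f.1) := nhds_induced _ _
  rw [h1, mem_comap] at hN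
  obtain ⟨M, hM, hMN⟩ := hN
  rw [nhds_pi, Filter.mem_pi] at hM
  obtain ⟨I, hI, t, ht, hsub⟩ := hM
  have h2 : ∀ i, ∀ᶠ m : ℕ in atTop, Metric.ball (f.1 i) (1 / ((m : ℝ) + 1)) ⊆ t i := by
    intro i
    obtain ⟨ε, hε, hb⟩ := Metric.mem_nhds_iff.1 (ht i)
    have := (tendsto_one_div_add_atTop_nhds_zero_nat (𝕜 := ℝ)).eventually (gt_mem_nhds hε)
    filter_upwards [this] with m hm
    exact (Metric.ball_subset_ball hm.le).trans hb
  have h3 : ∀ᶠ m : ℕ in atTop, ∀ i ∈ I, Metric.ball (f.1 i) (1 / ((m : ℝ) + 1)) ⊆ t i :=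
    (Filter.eventually_all_finite hI).2 fun i _ => h2 i
  obtain ⟨m, hm⟩ := h3.exists
  refine ⟨I, hI, m, fun g hg => hMN (hsub fun i hi => hm i hi ?_)⟩
  rw [Metric.mem_ball, Real.dist_eq]
  exact hg i hi

lemma eval_continuous (y : Y) : Continuous (fun g : Cp Y => g.1 y) :=
  (continuous_apply y).comp continuous_subtype_val

lemma exists_supp {Φ : Cp X → Cp Y} (hc : Continuous Φ) (y : Y) :
    ∃ m, ∃ A : Set X, A.Finite ∧ Supp Φ m A y := by
  have h : Continuous fun f : Cp X => |(Φ f).1 y - (Φ (zero X)).1 y| :=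
    (((eval_continuous y).comp hc).sub continuous_const).abs
  have hN : {f : Cp X | |(Φ f).1 y - (Φ (zero X)).1 y| < 1} ∈ 𝓝 (zero X) :=
    (isOpen_lt h continuous_const).mem_nhds (by simp)
  obtain ⟨A, hA, m, hm⟩ := nhds_basic _ _ hN
  exact ⟨m, A, hA, fun f hf => le_of_lt (hm f fun a ha => by simpa [zero] using hf a ha)⟩

lemma basic_open {A : Set X} (hA : A.Finite) (m : ℕ) :
    IsOpen {f : Cp X | ∀ a ∈ A, |f.1 a| < 1 / ((m : ℝ) + 1)} := by
  have : {f : Cp X | ∀ a ∈ A, |f.1 a| < 1 / ((m : ℝ) + 1)} =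
      ⋂ a ∈ A, {f : Cp X | |f.1 a| < 1 / ((m : ℝ) + 1)} := by ext; simp
  rw [this]
  exact hA.isOpen_biInter fun a _ => isOpen_lt (eval_continuous a).abs continuous_const

lemma finite_fiber [T4Space Y] {Φ : Cp X → Cp Y} (ho : IsOpenMap Φ) (m : ℕ)
    {A : Set X} (hA : A.Finite) : {y | Supp Φ m A y}.Finite := by
  have hopen := ho _ (basic_open hA m)
  have hmem : Φ (zero X) ∈ Φ '' {f : Cp X | ∀ a ∈ A, |f.1 a| < 1 / ((m : ℝ) + 1)} :=
    ⟨_, fun a _ => by simp only [zero, abs_zero]; positivity, rfl⟩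
  obtain ⟨B, hB, k, hk⟩ := nhds_basic _ _ (hopen.mem_nhds hmem)
  refine hB.subset fun y hy => ?_
  by_contra hyB
  obtain ⟨h, h0, h1, -⟩ := exists_continuous_zero_one_of_isClosed hB.isClosed
    (isClosed_singleton (x := y)) (Set.disjoint_singleton_right.2 hyB)
  let g : Cp Y := ⟨fun z => (Φ (zero X)).1 z + 2 * h z,
    (Φ (zero X)).2.add (continuous_const.mul h.continuous)⟩
  obtain ⟨f, hf, hfg⟩ := hk g (fun b hb => by
    have : h b = 0 := h0 hb
    simp only [g, this, mul_zero, add_zero, sub_self, abs_zero]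
    positivity)
  have h2 := hy f hf
  rw [hfg] at h2
  have : h y = 1 := h1 rfl
  simp only [g, this] at h2
  norm_num at h2

lemma isClosed_supp {Φ : Cp X → Cp Y} (m n : ℕ) :
    IsClosed {z : (Fin n → X) × Y | Supp Φ m (range z.1) z.2} := by
  have : {z : (Fin n → X) × Y | Supp Φ m (range z.1) z.2} = ⋂ f : Cp X,
      ((⋃ i : Fin n, {z | 1 / ((m : ℝ) + 1) ≤ |f.1 (z.1 i)|}) ∪
        {z | |(Φ f).1 z.2 - (Φ (zero X)).1 z.2| ≤ 1}) := by
    ext z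
    simp only [Supp, mem_ofPred_eq, forall_mem_range, mem_iInter, mem_union, mem_iUnion]
    refine forall_congr' fun f => ?_
    rw [imp_iff_not_or]
    push Not
    rfl
  rw [this]
  refine isClosed_iInter fun f => IsClosed.union (isClosed_iUnion_of_finite fun i => ?_) ?_
  · have := f.2
    exact isClosed_le continuous_const (by fun_prop)
  · have h1 := (Φ f).2
    have h2 := (Φ (zero X)).2
    exact isClosed_le (by fun_prop) continuous_const

lemma isolated [T4Space X] {Φ : Cp X → Cp Y} (hc : Continuous Φ) (m n : ℕ) (y : Y)
    (K : Set X) (hmin : ∀ A : Set X, A.Finite → A ⊆ K → Supp Φ m A y → n ≤ A.ncard)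
    (x : Fin n → X) (hxK : ∀ i, x i ∈ K) :
    ∀ᶠ x' in 𝓝[≠] x, ¬ Supp Φ m (range x') y := by
  classical
  by_contra hcon
  rw [Filter.not_eventually] at hcon
  simp only [not_not] at hcon
  have h1 : ∃ᶠ x' in 𝓝[≠] x, ∃ I : Finset (Fin n),
      Supp Φ m (range x') y ∧ x' ≠ x ∧ ∀ i, i ∈ I ↔ x' i = x i := by
    refine (hcon.and_eventually self_mem_nhdsWithin).mono ?_
    rintro x' ⟨h, hne⟩
    exact ⟨Finset.univ.filter fun i => x' i = x i, h, hne, by simp⟩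
  rw [Filter.frequently_exists] at h1
  obtain ⟨I, hI⟩ := h1
  have hI' := hI.filter_mono nhdsWithin_le_nhds
  have hIlt : I.card < n := by
    obtain ⟨x', -, hne, h⟩ := hI'.exists
    have : I ≠ Finset.univ := by
      rintro rfl
      exact hne (funext fun i => (h i).1 (Finset.mem_univ i))
    simpa using (Finset.card_lt_iff_ne_univ I).2 this
  have hR : (x '' (I : Set (Fin n))).Finite := I.finite_toSet.image x
  have hcard : (x '' (I : Set (Fin n))).ncard < n := by
    refine lt_of_le_of_lt (Set.ncard_image_le I.finite_toSet) ?_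
    simpa using hIlt
  refine absurd (hmin _ hR (by rintro _ ⟨i, -, rfl⟩; exact hxK i) ?_) (not_le.2 hcard)
  intro f hf
  refine le_of_forall_pos_le_add fun δ hδ => ?_
  have hN : {g : Cp X | |(Φ f).1 y - (Φ g).1 y| < δ} ∈ 𝓝 f :=
    (isOpen_lt (continuous_const.sub ((eval_continuous y).comp hc)).abs
      continuous_const).mem_nhds (by simpa using hδ)
  obtain ⟨F, hF, k, hk⟩ := nhds_basic _ _ hN
  have hF' : (F ∪ x '' (I : Set (Fin n))).Finite := hF.union hR
  have hev : ∀ᶠ x' in 𝓝 x, ∀ i, x' i ∉ (F ∪ x '' (I : Set (Fin n))) \ {x i} := by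
    rw [Filter.eventually_all]
    intro i
    have : IsOpen ((F ∪ x '' (I : Set (Fin n))) \ {x i})ᶜ := (hF'.sdiff).isClosed.isOpen_compl
    exact (this.preimage (continuous_apply i)).mem_nhds (x := x) (by simp)
  obtain ⟨x', ⟨hs, -, hxI⟩, hx'⟩ := (hI'.and_eventually hev).exists
  have hfin : (x' '' {i | i ∉ I}).Finite := Set.toFinite _
  have hdisj : Disjoint (x' '' {i | i ∉ I}) (F ∪ x '' (I : Set (Fin n))) := by
    rw [Set.disjoint_left]
    rintro _ ⟨i, hi, rfl⟩ h
    exact hx' i ⟨h, fun he => hi ((hxI i).2 he)⟩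
  obtain ⟨h, h0, h1, -⟩ := exists_continuous_zero_one_of_isClosed hfin.isClosed hF'.isClosed hdisj
  let g : Cp X := ⟨fun z => f.1 z * h z, f.2.mul h.continuous⟩
  have hg1 : ∀ a ∈ F ∪ x '' (I : Set (Fin n)), g.1 a = f.1 a := by
    intro a ha
    have : h a = 1 := h1 ha
    simp [g, this]
  have hgN := hk g (fun a ha => by
    rw [hg1 a (Or.inl ha), sub_self, abs_zero]; positivity)
  have hgs := hs g (by
    rintro _ ⟨i, rfl⟩
    by_cases hi : i ∈ I
    · rw [(hxI i).1 hi, hg1 _ (Or.inr ⟨i, hi, rfl⟩)]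
      exact hf _ ⟨i, hi, rfl⟩
    · have : h (x' i) = 0 := h0 ⟨i, hi, rfl⟩
      simp only [g, this, mul_zero, abs_zero]
      positivity)
  have hgN' : |(Φ f).1 y - (Φ g).1 y| < δ := hgN
  have := abs_sub_le ((Φ f).1 y) ((Φ g).1 y) ((Φ (zero X)).1 y)
  linarith

end Supp

lemma union {Y ι : Type*} [TopologicalSpace Y] [Countable ι] (S : ι → Set Y)
    (hS : ⋃ c, S c = univ)
    (h : ∀ c, ∀ U : ℕ → Set (Set Y), (∀ i, (∀ s ∈ U i, IsOpen s) ∧ ⋃₀ U i = univ) →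
      ∃ V : ℕ → Set (Set Y), Good U V ∧ S c ⊆ ⋃₀ ⋃ i, V i) : IsCSpace Y := by
  intro U hU
  rcases isEmpty_or_nonempty ι with hι | hι
  · refine ⟨fun _ => ∅, fun i => by simp, ?_⟩
    rw [← hS]; simp
  obtain ⟨g, hg⟩ := exists_surjective_nat ι
  let e : ℕ ≃ ℕ × ℕ := Nat.pairEquiv.symm
  have : ∃ V : ℕ → Set (Set Y), Good U V ∧ (univ : Set Y) ⊆ ⋃₀ ⋃ i, V i := by
    refine reindex e ?_
    have h1 := fun k : ℕ => h (g k) (fun j => U (e.symm (k, j))) (fun j => hU _)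
    choose V hV hc using h1
    refine ⟨fun p => V p.1 p.2, fun p => hV p.1 p.2, fun y _ => ?_⟩
    have hy : y ∈ ⋃ c, S c := by rw [hS]; trivial
    obtain ⟨c, hyc⟩ := mem_iUnion.1 hy
    obtain ⟨k, rfl⟩ := hg c
    obtain ⟨v, hv, hyv⟩ := hc k hyc
    obtain ⟨j, hj⟩ := mem_iUnion.1 hv
    exact ⟨v, mem_iUnion.2 ⟨(k, j), hj⟩, hyv⟩
  obtain ⟨V, hV, hc⟩ := this
  exact ⟨V, hV, univ_subset_iff.1 hc⟩

end CSpaceAux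

open CSpaceAux in
/-- If `X`, `Y` are σ-compact metrizable spaces, `C_p(Y)` is the image of `C_p(X)` under
a continuous open mapping, and `X` is a `C`-space, then `Y` is a `C`-space. -/
theorem cSpace_preserved {X Y : Type*}
    [TopologicalSpace X] [SigmaCompactSpace X] [TopologicalSpace.MetrizableSpace X]
    [TopologicalSpace Y] [SigmaCompactSpace Y] [TopologicalSpace.MetrizableSpace Y]
    (hΦ : ∃ Φ : Cp X → Cp Y, Continuous Φ ∧ IsOpenMap Φ ∧ Function.Surjective Φ)
    (hX : IsCSpace X) : IsCSpace Y := by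
  obtain ⟨Φ, hc, ho, -⟩ := hΦ
  let _ := TopologicalSpace.metrizableSpaceMetric X
  let _ := TopologicalSpace.metrizableSpaceMetric Y
  have : SecondCountableTopology X := EMetric.secondCountable_of_sigmaCompact X
  have huniv : CSet (Set.univ : Set X) := by
    intro U hU
    obtain ⟨V, hV, hcov⟩ := hX U (fun i => ⟨(hU i).1, Set.univ_subset_iff.1 (hU i).2⟩)
    exact ⟨V, hV, hcov.ge⟩
  let K : ℕ → Set X := compactCovering X
  let L : ℕ → Set Y := compactCovering Y
  have hK : ∀ j, IsCompact (K j) := isCompact_compactCovering X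
  have hL : ∀ j, IsCompact (L j) := isCompact_compactCovering Y
  have hKC : ∀ j, CSet (K j) := fun j =>
    CSet.of_inj (hK j) huniv id continuous_id (fun _ _ => trivial) (Function.injective_id.injOn)
  let P : (c : Σ n : ℕ, ℕ × ℕ × ℕ × TopologicalSpace.countableBasis (Fin n → X)) →
      Set ((Fin c.1 → X) × Y) := fun c =>
    (({x | ∀ i, x i ∈ K c.2.2.1} ∩ closure c.2.2.2.2.1) ×ˢ L c.2.2.2.1) ∩
      {z | Supp Φ c.2.1 (Set.range z.1) z.2}
  have hPc : ∀ c, IsCompact (P c) := fun c =>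
    ((((isCompact_pi_infinite fun _ => hK _).inter_right isClosed_closure).prod (hL _)).inter_right
      (isClosed_supp _ _))
  have hPC : ∀ c, CSet (P c) := fun c => by
    refine CSet.fiber (hPc c) (CSet.pow (hK c.2.2.1) (hKC _) c.1) Prod.fst continuous_fst
      (fun z hz => hz.1.1.1) fun q => CSet.of_finite ?_
    refine ((finite_fiber ho c.2.1 (Set.finite_range q)).image (fun y => (q, y))).subset ?_
    rintro ⟨x, y⟩ ⟨hz, rfl⟩
    exact ⟨y, hz.2, rfl⟩
  refine CSpaceAux.union (fun c => {y | ∃! z, z ∈ P c ∧ z.2 = y}) ?_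
    (fun c U hU => sing (hPc c) (hPC c) Prod.snd continuous_snd U hU)
  refine Set.eq_univ_of_forall fun y => ?_
  obtain ⟨m, A, hA, hAs⟩ := exists_supp hc y
  obtain ⟨j, hj⟩ : ∃ j, A ⊆ K j := by
    have h1 : ∀ a ∈ A, ∀ᶠ j in Filter.atTop, a ∈ K j := fun a _ => by
      obtain ⟨j, hj⟩ := Set.mem_iUnion.1 ((iUnion_compactCovering X).ge (Set.mem_univ a))
      filter_upwards [Filter.eventually_ge_atTop j] with k hk
      exact compactCovering_subset X hk hj
    obtain ⟨j, hj⟩ := ((Filter.eventually_all_finite hA).2 h1).exists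
    exact ⟨j, hj⟩
  obtain ⟨l, hl⟩ := Set.mem_iUnion.1 ((iUnion_compactCovering Y).ge (Set.mem_univ y))
  classical
  have hex : ∃ n, ∃ A : Set X, A.Finite ∧ A ⊆ K j ∧ Supp Φ m A y ∧ A.ncard = n :=
    ⟨_, A, hA, hj, hAs, rfl⟩
  let n := Nat.find hex
  obtain ⟨B, hB, hBK, hBs, hBn⟩ := Nat.find_spec hex
  have hmin : ∀ A : Set X, A.Finite → A ⊆ K j → Supp Φ m A y → n ≤ A.ncard :=
    fun A h1 h2 h3 => Nat.find_min' hex ⟨A, h1, h2, h3, rfl⟩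
  obtain ⟨x, hx⟩ : ∃ x : Fin n → X, Set.range x = B := by
    have := hB.to_subtype
    have : Nat.card B = n := hBn
    let e := Finite.equivFinOfCardEq this
    exact ⟨fun i => (e.symm i).1, by
      rw [Set.range_comp' Subtype.val e.symm]; simp⟩
  have hxK : ∀ i, x i ∈ K j := fun i => hBK (hx ▸ Set.mem_range_self i)
  have hiso := isolated hc m n y (K j) hmin x hxK
  rw [eventually_nhdsWithin_iff] at hiso
  obtain ⟨b, hb, hxb, hbs⟩ := (TopologicalSpace.isBasis_countableBasis (Fin n → X)).exists_closure_subset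
    hiso
  refine Set.mem_iUnion.2 ⟨⟨n, m, j, l, ⟨b, hb⟩⟩, (x, y), ⟨⟨⟨⟨hxK, subset_closure hxb⟩, hl⟩, ?_⟩, rfl⟩, ?_⟩
  · change Supp Φ m (Set.range x) y
    rw [hx]; exact hBs
  · rintro ⟨x', y'⟩ ⟨⟨⟨⟨-, hx'b⟩, -⟩, hs⟩, hy'⟩
    by_contra hne
    change y' = y at hy'
    subst hy'
    exact hbs hx'b (fun h => hne (by rw [show x' = x from h])) hs
end

section
/- Let X and Y be metrizable spaces such that C_p(Y) is the image of C_p(X) under a continuous open mapping. If X is countable-dimensional, then Y is countable-dimensional. -/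
/-- `CovDimLE Z n` : the covering dimension of `Z` is at most `n`, i.e. every finite open
cover of `Z` admits a finite open refinement (still covering `Z`) in which every point
belongs to at most `n + 1` members. -/
def CovDimLE (Z : Type*) [TopologicalSpace Z] (n : ℕ) : Prop :=
  ∀ U : Set (Set Z), U.Finite → (∀ s ∈ U, IsOpen s) → ⋃₀ U = Set.univ →
    ∃ V : Set (Set Z), V.Finite ∧ (∀ s ∈ V, IsOpen s) ∧ ⋃₀ V = Set.univ ∧
      (∀ s ∈ V, ∃ t ∈ U, s ⊆ t) ∧
      ∀ z : Z, {s ∈ V | z ∈ s}.ncard ≤ n + 1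

/-- A space is countable-dimensional if it is a countable union of finite-dimensional
subspaces. -/
def CountableDimensional (Z : Type*) [TopologicalSpace Z] : Prop :=
  ∃ S : ℕ → Set Z, (⋃ i, S i) = Set.univ ∧ ∀ i, ∃ n : ℕ, CovDimLE ↥(S i) n

section CdHelpers
open Set Filter Topology

theorem cd_sig_aux {S : Type*} [MetricSpace S] (ε δ : ℝ) (hδ : 0 < δ) :
    ∃ (O : Set S) (c : S → S), IsOpen O ∧
      (∀ y ∈ O, dist y (c y) < ε ∧ ∀ᶠ y' in 𝓝 y, c y' = c y) ∧
      ∃ M : Set S, IsClosed M ∧ M ⊆ O ∧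
      ∀ y, ∀ x, dist x y ≤ ε - 3 * δ → (∀ x', WellOrderingRel x' x → ε ≤ dist x' y) → y ∈ M := by
  classical
  set Mx : S → Set S := fun x => {y | dist x y ≤ ε - 3 * δ ∧ ∀ x', WellOrderingRel x' x → ε ≤ dist x' y} with hMx
  set V : S → Set S := fun x => ⋃ m ∈ Mx x, Metric.ball m δ with hV
  have sep : ∀ x x' y y', y ∈ Mx x → y' ∈ Mx x' → dist y y' < 3 * δ → x = x' := by
    intro x x' y y' hy hy' hd
    rcases trichotomous_of WellOrderingRel x x' with h | h | h
    · have h1 := hy'.2 x h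
      have h2 := hy.1
      have := dist_triangle x y y'
      linarith
    · exact h
    · have h1 := hy.2 x' h
      have h2 := hy'.1
      have := dist_triangle x' y' y
      rw [dist_comm y' y] at this
      linarith
  have Vdisj : ∀ x x' y, y ∈ V x → y ∈ V x' → x = x' := by
    intro x x' y h h'
    simp only [hV, mem_iUnion, Metric.mem_ball] at h h'
    obtain ⟨m, hm, h⟩ := h
    obtain ⟨m', hm', h'⟩ := h'
    refine sep x x' m m' hm hm' ?_
    have := dist_triangle m y m'
    rw [dist_comm m y] at this
    linarith
  have Vopen : ∀ x, IsOpen (V x) := fun x => isOpen_biUnion fun m _ => Metric.isOpen_ball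
  set c : S → S := fun y => if h : ∃ x, y ∈ V x then h.choose else y with hc
  have cV : ∀ x y, y ∈ V x → c y = x := by
    intro x y h
    have h' : ∃ x, y ∈ V x := ⟨x, h⟩
    simp only [hc, dif_pos h']
    exact Vdisj _ _ _ h'.choose_spec h
  refine ⟨⋃ x, V x, c, isOpen_iUnion Vopen, ?_, ⋃ x, Mx x, ?_, ?_, ?_⟩
  · intro y hy
    obtain ⟨x, hx⟩ := mem_iUnion.1 hy
    rw [cV x y hx]
    constructor
    · simp only [hV, mem_iUnion, Metric.mem_ball] at hx
      obtain ⟨m, hm, h⟩ := hx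
      have h1 := hm.1
      have := dist_triangle y m x
      rw [dist_comm m x] at this
      linarith
    · filter_upwards [(Vopen x).mem_nhds hx] with y' hy' using cV x y' hy'
  · refine LocallyFinite.isClosed_iUnion ?_ ?_
    · intro y
      refine ⟨Metric.ball y δ, Metric.ball_mem_nhds _ hδ, Set.Subsingleton.finite ?_⟩
      rintro x ⟨a, ha, ha'⟩ x' ⟨b, hb, hb'⟩
      refine sep x x' a b ha hb ?_
      have := dist_triangle a y b
      rw [Metric.mem_ball] at ha' hb'
      rw [dist_comm y b] at this
      linarith
    · intro x
      have : Mx x = {y | dist x y ≤ ε - 3 * δ} ∩ ⋂ x', ⋂ (_ : WellOrderingRel x' x), {y | ε ≤ dist x' y} := by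
        ext y; simp [hMx]
      rw [this]
      refine IsClosed.inter (isClosed_le (by fun_prop) (by fun_prop)) ?_
      exact isClosed_iInter fun x' => isClosed_iInter fun _ => isClosed_le (by fun_prop) (by fun_prop)
  · refine iUnion_mono fun x m hm => ?_
    simp only [hV, mem_iUnion]
    exact ⟨m, hm, Metric.mem_ball_self hδ⟩
  · intro y x h1 h2
    exact mem_iUnion.2 ⟨x, h1, h2⟩

theorem cd_sig (S : Type*) [MetricSpace S] (ε : ℝ) (hε : 0 < ε) :
    ∃ (M O : ℕ → Set S) (c : ℕ → S → S), (∀ j, IsClosed (M j)) ∧ (∀ j, IsOpen (O j)) ∧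
      (∀ j, M j ⊆ O j) ∧ (∀ y, ∃ j, y ∈ M j) ∧
      (∀ j, ∀ y ∈ O j, dist y (c j y) < ε ∧ ∀ᶠ y' in 𝓝 y, c j y' = c j y) := by
  have h := fun j : ℕ => cd_sig_aux (S := S) ε (1 / ((j : ℝ) + 1)) (by positivity)
  choose O c hO hc M hM hMO hcov using h
  refine ⟨M, O, c, hM, hO, hMO, ?_, hc⟩
  intro y
  have hne : {x | dist x y < ε}.Nonempty := ⟨y, by simpa using hε⟩
  have wf : WellFounded (WellOrderingRel (α := S)) := IsWellFounded.wf
  set x := wf.min _ hne with hx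
  have h1 : dist x y < ε := wf.min_mem _ hne
  obtain ⟨j, hj⟩ := exists_nat_one_div_lt (show 0 < (ε - dist x y) / 3 by linarith)
  refine ⟨j, hcov j y x (by linarith) ?_⟩
  intro x' hx'
  by_contra hcon
  push Not at hcon
  exact wf.not_lt_min _ hcon hx'

theorem cd_step {S : Type*} [TopologicalSpace S] [NormalSpace S] {n : ℕ} (hd : CovDimLE S n)
    (N : ℕ) (A B : ℕ → Set S) (hA : ∀ i, IsClosed (A i)) (hB : ∀ i, IsClosed (B i))
    (hAB : ∀ i, Disjoint (A i) (B i)) :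
    ∃ A' B' : ℕ → Set S, (∀ i, IsClosed (A' i)) ∧ (∀ i, IsClosed (B' i)) ∧
      (∀ i, Disjoint (A' i) (B' i)) ∧ (∀ i, A i ⊆ A' i) ∧ (∀ i, B i ⊆ B' i) ∧
      (∀ i < N, A i ⊆ interior (A' i)) ∧ (∀ i < N, B i ⊆ interior (B' i)) ∧
      ∀ x, ∀ I : Finset ℕ, (∀ i ∈ I, i < N ∧ x ∉ A' i ∧ x ∉ B' i) → I.card ≤ n := by
  classical
  set W : Finset ℕ → Set S := fun T => ⋂ i ∈ Finset.range N, (if i ∈ T then (A i)ᶜ else (B i)ᶜ) with hW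
  obtain ⟨V, hVf, hVo, hVc, hVr, hVn⟩ := hd (W '' ((Finset.range N).powerset : Set (Finset ℕ)))
    ((Finset.finite_toSet _).image _)
    (by
      rintro _ ⟨T, -, rfl⟩
      refine isOpen_biInter_finset fun i _ => ?_
      split_ifs
      · exact (hA i).isOpen_compl
      · exact (hB i).isOpen_compl)
    (by
      refine eq_univ_of_forall fun x => ?_
      refine ⟨W ((Finset.range N).filter fun i => x ∉ A i), ⟨_, Finset.mem_coe.2 (Finset.mem_powerset.2 (Finset.filter_subset _ _)), rfl⟩, ?_⟩
      simp only [hW, mem_iInter]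
      intro i hi
      split_ifs with h
      · exact (Finset.mem_filter.1 h).2
      · intro hb
        apply h
        exact Finset.mem_filter.2 ⟨hi, fun ha => Set.disjoint_left.1 (hAB i) ha hb⟩)
  have hmeet : ∀ v ∈ V, ∀ i < N, (v ∩ A i).Nonempty → v ∩ B i = ∅ := by
    intro v hv i hi hne
    obtain ⟨_, ⟨T, -, rfl⟩, ht⟩ := hVr v hv
    obtain ⟨a, ha, haA⟩ := hne
    have h1 := ht ha
    simp only [hW, mem_iInter] at h1
    have h1 := h1 i (Finset.mem_range.2 hi)
    have hiT : i ∉ T := by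
      intro h
      rw [if_pos h] at h1
      exact h1 haA
    ext b
    simp only [mem_inter_iff, mem_empty_iff_false, iff_false, not_and]
    intro hb
    have h2 := ht hb
    simp only [hW, mem_iInter] at h2
    have h2 := h2 i (Finset.mem_range.2 hi)
    rw [if_neg hiT] at h2
    exact h2
  have : Finite V := hVf.to_subtype
  obtain ⟨F, hFc, hFcl, hFV⟩ := exists_iUnion_eq_closed_subset (u := fun v : V => (v : Set S))
    (fun v => hVo v v.2) (fun x => Set.toFinite _) (by rw [← sUnion_eq_iUnion]; exact hVc)
  have hg : ∀ v : V, ∃ g : C(S, ℝ), EqOn g 0 (v : Set S)ᶜ ∧ EqOn g 1 (F v) ∧ ∀ x, g x ∈ Icc (0:ℝ) 1 := by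
    intro v
    refine exists_continuous_zero_one_of_isClosed (hVo v v.2).isClosed_compl (hFcl v) ?_
    exact Set.disjoint_left.2 fun x hx hx' => hx (hFV v hx')
  choose g hg0 hg1 hg01 using hg
  set a : ℕ → ℝ := fun i => 1 / ((i : ℝ) + 3) with ha
  set b : ℕ → ℝ := fun i => 1 / ((i : ℝ) + 2) with hb
  have hab : ∀ i, a i < b i := fun i => by
    simp only [ha, hb]; apply one_div_lt_one_div_of_lt <;> [positivity; linarith]
  have ha0 : ∀ i, 0 < a i := fun i => by simp only [ha]; positivity
  have hb1 : ∀ i, b i < 1 := fun i => by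
    simp only [hb]; rw [div_lt_one (by positivity)]
    have : (0 : ℝ) ≤ i := by positivity
    linarith
  have hba : ∀ i j, i < j → b j ≤ a i := fun i j hij => by
    simp only [ha, hb]
    have : (i : ℝ) + 1 ≤ j := by exact_mod_cast hij
    apply one_div_le_one_div_of_le <;> [positivity; linarith]
  set J : ℕ → Set V := fun i => {v | ((v : Set S) ∩ A i).Nonempty} with hJ
  have hcov : ∀ x, ∃ v, x ∈ F v := fun x => by
    have : x ∈ ⋃ v, F v := by rw [hFc]; trivial
    exact mem_iUnion.1 this
  have hAint : ∀ i, A i ⊆ ⋃ v ∈ J i, {x | b i < g v x} := by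
    intro i x hx
    obtain ⟨v, hv⟩ := hcov x
    simp only [mem_iUnion]
    refine ⟨v, ⟨x, hFV v hv, hx⟩, ?_⟩
    have := hg1 v hv
    simp only [Pi.one_apply] at this
    simp only [mem_ofPred_eq, this]
    exact hb1 i
  have hBint : ∀ i < N, B i ⊆ ⋂ v ∈ J i, {x | g v x < a i} := by
    intro i hi x hx
    simp only [mem_iInter]
    intro v hv
    have hxv : x ∈ (v : Set S)ᶜ := fun h => by
      have := hmeet v v.2 i hi hv
      exact (this ▸ (⟨h, hx⟩ : x ∈ (v : Set S) ∩ B i) : x ∈ (∅ : Set S))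
    have := hg0 v hxv
    simp only [Pi.zero_apply] at this
    simp only [mem_ofPred_eq, this]
    exact ha0 i
  have hAi : ∀ i, A i ⊆ interior (⋃ v ∈ J i, {x | b i ≤ g v x}) := fun i =>
    (hAint i).trans (interior_maximal (iUnion₂_mono fun v _ x hx => by
      rw [mem_ofPred_eq] at hx ⊢; exact hx.le)
      (isOpen_biUnion fun v _ => isOpen_lt (by fun_prop) (by fun_prop)))
  have hBi : ∀ i < N, B i ⊆ interior (⋂ v ∈ J i, {x | g v x ≤ a i}) := fun i hi =>
    (hBint i hi).trans (interior_maximal (iInter₂_mono fun v _ x hx => by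
      rw [mem_ofPred_eq] at hx ⊢; exact hx.le)
      ((Set.toFinite (J i)).isOpen_biInter fun v _ => isOpen_lt (by fun_prop) (by fun_prop)))
  refine ⟨fun i => if i < N then ⋃ v ∈ J i, {x | b i ≤ g v x} else A i,
    fun i => if i < N then ⋂ v ∈ J i, {x | g v x ≤ a i} else B i, ?_, ?_, ?_, ?_, ?_, ?_, ?_, ?_⟩
  · intro i
    dsimp only
    split_ifs
    · exact (Set.toFinite (J i)).isClosed_biUnion fun v _ => isClosed_le (by fun_prop) (by fun_prop)
    · exact hA i
  · intro i
    dsimp only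
    split_ifs
    · exact isClosed_biInter fun v _ => isClosed_le (by fun_prop) (by fun_prop)
    · exact hB i
  · intro i
    dsimp only
    split_ifs
    · refine Set.disjoint_left.2 fun x hx hx' => ?_
      simp only [mem_iUnion, mem_iInter, mem_ofPred_eq] at hx hx'
      obtain ⟨v, hv, h⟩ := hx
      have := hx' v hv
      have := hab i
      linarith
    · exact hAB i
  · intro i
    dsimp only
    split_ifs
    · exact (hAi i).trans interior_subset
    · exact Subset.rfl
  · intro i
    dsimp only
    split_ifs with h
    · exact (hBi i h).trans interior_subset
    · exact Subset.rfl
  · intro i hi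
    simp only [if_pos hi]
    exact hAi i
  · intro i hi
    simp only [if_pos hi]
    exact hBi i hi
  · intro x I hI
    have key : ∀ i ∈ I, ∃ v : V, a i < g v x ∧ g v x < b i := by
      intro i hi
      obtain ⟨h1, h2, h3⟩ := hI i hi
      simp only [if_pos h1, mem_iUnion, mem_iInter, mem_ofPred_eq] at h2 h3
      push Not at h2 h3
      obtain ⟨v, hv, h⟩ := h3
      exact ⟨v, h, h2 v hv⟩
    obtain ⟨v0, hv0⟩ := hcov x
    have : Nonempty V := ⟨v0⟩
    choose! w hw using key
    have hv01 := hg1 v0 hv0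
    simp only [Pi.one_apply] at hv01
    have hinj : Set.InjOn w I := by
      intro i hi j hj hij
      have h1 := hw i hi
      have h2 := hw j hj
      rw [← hij] at h2
      rcases lt_trichotomy i j with h | h | h
      · have := hba i j h; linarith
      · exact h
      · have := hba j i h; linarith
    have hnot : v0 ∉ I.image w := by
      intro h
      obtain ⟨i, hi, rfl⟩ := Finset.mem_image.1 h
      have := hw i hi
      have := hb1 i
      linarith
    have hsub : (((insert v0 (I.image w)).image (fun v : V => (v : Set S)) : Finset (Set S)) : Set (Set S))
        ⊆ {s ∈ V | x ∈ s} := by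
      intro s hs
      simp only [Finset.coe_image, mem_image, Finset.mem_coe] at hs
      obtain ⟨v, hv, rfl⟩ := hs
      refine ⟨v.2, ?_⟩
      rcases Finset.mem_insert.1 hv with rfl | hv
      · exact hFV _ hv0
      · obtain ⟨i, hi, rfl⟩ := Finset.mem_image.1 hv
        by_contra hx
        have h0 := hg0 (w i) hx
        simp only [Pi.zero_apply] at h0
        have := hw i hi
        have := ha0 i
        linarith
    have h1 := Set.ncard_le_ncard hsub (hVf.subset (fun s hs => hs.1))
    rw [Set.ncard_coe_finset, Finset.card_image_of_injective _ Subtype.val_injective,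
      Finset.card_insert_of_notMem hnot, Finset.card_image_of_injOn hinj] at h1
    have := hVn x
    omega

theorem cd_iter {S : Type*} [TopologicalSpace S] [NormalSpace S] {n : ℕ} (hd : CovDimLE S n)
    (A B : ℕ → Set S) (hA : ∀ i, IsClosed (A i)) (hB : ∀ i, IsClosed (B i))
    (hAB : ∀ i, Disjoint (A i) (B i)) :
    ∃ G H : ℕ → Set S, (∀ i, IsOpen (G i)) ∧ (∀ i, IsOpen (H i)) ∧
      (∀ i, Disjoint (G i) (H i)) ∧ (∀ i, A i ⊆ G i) ∧ (∀ i, B i ⊆ H i) ∧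
      ∀ x, {i | x ∉ G i ∧ x ∉ H i}.Finite := by
  classical
  let St := {p : (ℕ → Set S) × (ℕ → Set S) //
    (∀ i, IsClosed (p.1 i)) ∧ (∀ i, IsClosed (p.2 i)) ∧ ∀ i, Disjoint (p.1 i) (p.2 i)}
  have hstep : ∀ (N : ℕ) (p : St), ∃ q : St, (∀ i, p.1.1 i ⊆ q.1.1 i) ∧ (∀ i, p.1.2 i ⊆ q.1.2 i) ∧
      (∀ i < N, p.1.1 i ⊆ interior (q.1.1 i)) ∧ (∀ i < N, p.1.2 i ⊆ interior (q.1.2 i)) ∧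
      ∀ x, ∀ I : Finset ℕ, (∀ i ∈ I, i < N ∧ x ∉ q.1.1 i ∧ x ∉ q.1.2 i) → I.card ≤ n := by
    intro N p
    obtain ⟨A', B', h1, h2, h3, h4⟩ := cd_step hd N p.1.1 p.1.2 p.2.1 p.2.2.1 p.2.2.2
    exact ⟨⟨(A', B'), h1, h2, h3⟩, h4⟩
  choose nx hnA hnB hniA hniB hncard using hstep
  let q : ℕ → St := fun t => Nat.rec ⟨(A, B), hA, hB, hAB⟩ (fun t p => nx t p) t
  have hq : ∀ t, q (t + 1) = nx t (q t) := fun t => rfl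
  have monoA : ∀ i, Monotone fun t => (q t).1.1 i := fun i =>
    monotone_nat_of_le_succ fun t => by rw [hq]; exact hnA t (q t) i
  have monoB : ∀ i, Monotone fun t => (q t).1.2 i := fun i =>
    monotone_nat_of_le_succ fun t => by rw [hq]; exact hnB t (q t) i
  refine ⟨fun i => ⋃ t, (q t).1.1 i, fun i => ⋃ t, (q t).1.2 i, ?_, ?_, ?_, ?_, ?_, ?_⟩
  · intro i
    rw [isOpen_iff_mem_nhds]
    intro x hx
    obtain ⟨t, ht⟩ := mem_iUnion.1 hx
    have h1 := monoA i (le_max_left t (i + 1)) ht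
    have h2 := hniA (max t (i + 1)) (q _) i (by omega) h1
    rw [← hq] at h2
    refine mem_of_superset (mem_interior_iff_mem_nhds.1 h2) ?_
    exact subset_iUnion (fun t => (q t).1.1 i) (max t (i + 1) + 1)
  · intro i
    rw [isOpen_iff_mem_nhds]
    intro x hx
    obtain ⟨t, ht⟩ := mem_iUnion.1 hx
    have h1 := monoB i (le_max_left t (i + 1)) ht
    have h2 := hniB (max t (i + 1)) (q _) i (by omega) h1
    rw [← hq] at h2
    refine mem_of_superset (mem_interior_iff_mem_nhds.1 h2) ?_
    exact subset_iUnion (fun t => (q t).1.2 i) (max t (i + 1) + 1)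
  · intro i
    refine Set.disjoint_left.2 fun x hx hx' => ?_
    obtain ⟨t, ht⟩ := mem_iUnion.1 hx
    obtain ⟨t', ht'⟩ := mem_iUnion.1 hx'
    exact Set.disjoint_left.1 ((q (max t t')).2.2.2 i) (monoA i (le_max_left t t') ht)
      (monoB i (le_max_right t t') ht')
  · intro i
    exact subset_iUnion (fun t => (q t).1.1 i) 0
  · intro i
    exact subset_iUnion (fun t => (q t).1.2 i) 0
  · intro x
    by_contra hinf
    obtain ⟨I, hI, hcard⟩ := (Set.Infinite.exists_subset_card_eq hinf (n + 1))
    have := hncard (I.sup id + 1) (q (I.sup id + 1)) x I (by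
      intro i hi
      have h1 := hI hi
      simp only [mem_iUnion, not_exists, mem_ofPred_eq] at h1
      rw [← hq]
      refine ⟨Nat.lt_succ_of_le (Finset.le_sup (f := id) hi), h1.1 (I.sup id + 1 + 1), h1.2 (I.sup id + 1 + 1)⟩)
    omega

def CdZD {S : Type*} [TopologicalSpace S] (T : Type*) (Z : Set S) : Prop :=
  ∃ g : ℕ → S → T, (∀ k, ∀ x ∈ Z, ∀ᶠ x' in 𝓝[Z] x, g k x' = g k x) ∧
    ∀ x ∈ Z, ∀ U ∈ 𝓝 x, ∃ N, ∀ x' ∈ Z, (∀ k < N, g k x' = g k x) → x' ∈ U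

theorem cd_decomp {S : Type*} [MetricSpace S] {n : ℕ} (hd : CovDimLE S n) :
    ∃ Z : Finset ℕ → Set S, (∀ x, ∃ F, x ∈ Z F) ∧ ∀ F, CdZD (Option S) (Z F) := by
  classical
  choose M O c hM hO hMO hcov hc using fun k : ℕ => cd_sig S (1 / ((k : ℝ) + 1)) (by positivity)
  let K : ℕ → ℕ := fun i => i.unpair.1
  let J : ℕ → ℕ := fun i => i.unpair.2.unpair.1
  obtain ⟨G, H, hG, hH, hGH, hAG, hBH, hfin⟩ := cd_iter hd (fun i => M (K i) (J i))
    (fun i => (O (K i) (J i))ᶜ) (fun i => hM _ _) (fun i => (hO _ _).isClosed_compl)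
    (fun i => Set.disjoint_left.2 fun x hx hx' => hx' (hMO _ _ hx))
  have hGO : ∀ i, G i ⊆ O (K i) (J i) := fun i x hx => by
    by_contra h
    exact Set.disjoint_left.1 (hGH i) hx (hBH i h)
  refine ⟨fun F => {x | ∀ i, x ∉ G i → x ∉ H i → i ∈ F}, ?_, ?_⟩
  · intro x
    refine ⟨(hfin x).toFinset, fun i h1 h2 => ?_⟩
    rw [Set.Finite.mem_toFinset]
    exact ⟨h1, h2⟩
  · intro F
    refine ⟨fun i x => if i ∉ F ∧ x ∈ G i then some (c (K i) (J i) x) else none, ?_, ?_⟩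
    · intro i x hx
      by_cases hi : i ∈ F
      · simp [hi]
      · have : x ∈ G i ∨ x ∈ H i := by
          by_contra h
          push Not at h
          exact hi (hx i h.1 h.2)
        rcases this with h | h
        · filter_upwards [mem_nhdsWithin_of_mem_nhds ((hG i).mem_nhds h),
            mem_nhdsWithin_of_mem_nhds (hc _ _ x (hGO i h)).2] with x' h1 h2
          rw [if_pos ⟨hi, h1⟩, if_pos ⟨hi, h⟩]
          exact congrArg some h2
        · filter_upwards [mem_nhdsWithin_of_mem_nhds ((hH i).mem_nhds h)] with x' h1
          rw [if_neg (fun h' => Set.disjoint_left.1 (hGH i) h'.2 h1),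
            if_neg (fun h' => Set.disjoint_left.1 (hGH i) h'.2 h)]
    · intro x hx U hU
      obtain ⟨r, hr, hrU⟩ := Metric.mem_nhds_iff.1 hU
      obtain ⟨k, hk⟩ := exists_nat_one_div_lt (show 0 < r / 2 by linarith)
      obtain ⟨j, hj⟩ := hcov k x
      obtain ⟨t, ht⟩ : ∃ t, Nat.pair k (Nat.pair j t) ∉ F := by
        by_contra hcon
        push Not at hcon
        refine Set.infinite_of_injective_forall_mem (f := fun t => Nat.pair k (Nat.pair j t))
          (s := (F : Set ℕ)) ?_ hcon F.finite_toSet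
        intro t t' h
        have h := (Nat.pair_eq_pair.1 h).2
        exact (Nat.pair_eq_pair.1 h).2
      set i := Nat.pair k (Nat.pair j t) with hi
      have hKi : K i = k := by simp [K, hi]
      have hJi : J i = j := by simp [J, hi]
      have hxG : x ∈ G i := hAG i (by simp only [hKi, hJi]; exact hj)
      refine ⟨i + 1, fun x' hx' h => hrU ?_⟩
      have h := h i (Nat.lt_succ_self i)
      dsimp only at h
      have hx1 : (if i ∉ F ∧ x ∈ G i then some (c (K i) (J i) x) else none) =
          some (c (K i) (J i) x) := if_pos ⟨ht, hxG⟩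
      rw [hx1] at h
      by_cases hx'G : x' ∈ G i
      · have hx2 : (if i ∉ F ∧ x' ∈ G i then some (c (K i) (J i) x') else none) =
          some (c (K i) (J i) x') := if_pos ⟨ht, hx'G⟩
        rw [hx2] at h
        have h := Option.some_injective _ h
        have h1 := (hc _ _ x (hGO i hxG)).1
        have h2 := (hc _ _ x' (hGO i hx'G)).1
        rw [h] at h2
        have := dist_triangle x' (c (K i) (J i) x) x
        rw [dist_comm (c (K i) (J i) x) x] at this
        rw [hKi] at h1 h2 this
        rw [Metric.mem_ball]
        linarith
      · rw [if_neg (fun h' => hx'G h'.2)] at h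
        cases h

theorem cd_zd_image {X : Type*} [TopologicalSpace X] (A : Set X) (Z : Set A)
    (h : CdZD (Option A) Z) : CdZD (Option X) (Subtype.val '' Z) := by
  classical
  obtain ⟨g, h1, h2⟩ := h
  refine ⟨fun k x => if hx : x ∈ A then (g k ⟨x, hx⟩).map Subtype.val else none, ?_, ?_⟩
  · rintro k _ ⟨x, hx, rfl⟩
    have := h1 k x hx
    rw [← IsEmbedding.subtypeVal.map_nhdsWithin_eq, eventually_map]
    filter_upwards [this] with x' hx'
    simp only [Subtype.coe_prop, dif_pos, hx']
  · rintro _ ⟨x, hx, rfl⟩ U hU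
    obtain ⟨N, hN⟩ := h2 x hx (Subtype.val ⁻¹' U) (continuous_subtype_val.continuousAt hU)
    refine ⟨N, ?_⟩
    rintro _ ⟨x', hx', rfl⟩ h
    refine hN x' hx' fun k hk => ?_
    have := h k hk
    simp only [Subtype.coe_prop, dif_pos] at this
    exact Option.map_injective Subtype.val_injective this

theorem cd_zd_dim {Y : Type*} [TopologicalSpace Y] {T : Type*} (Q : Set Y) (h : CdZD T Q) :
    CovDimLE Q 0 := by
  classical
  obtain ⟨g, h1, h2⟩ := h
  intro U hUf hUo hUc
  let cell : ℕ → Q → Set Q := fun N z => {x | ∀ k < N, g k x = g k z}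
  have cell_open : ∀ N z, cell N z ∈ 𝓝 z := by
    intro N z
    have : ∀ k ∈ Set.Iio N, ∀ᶠ x : Q in 𝓝 z, g k (x : Y) = g k z := by
      intro k _
      have := h1 k z z.2
      rw [nhdsWithin_eq_map_subtype_coe z.2] at this
      exact this
    have := (Filter.eventually_all_finite (Set.finite_Iio N)).2 this
    filter_upwards [this] with x hx k hk using hx k hk
  have hex : ∀ z, ∃ N, ∃ s ∈ U, cell N z ⊆ s := by
    intro z
    have hz : z ∈ ⋃₀ U := by rw [hUc]; trivial
    obtain ⟨s, hs, hzs⟩ := hz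
    have := (hUo s hs).mem_nhds hzs
    rw [nhds_subtype, mem_comap] at this
    obtain ⟨t, ht, hts⟩ := this
    obtain ⟨N, hN⟩ := h2 z z.2 t ht
    exact ⟨N, s, hs, fun x hx => hts (hN x x.2 hx)⟩
  let N : Q → ℕ := fun z => Nat.find (hex z)
  have hcelleq : ∀ n z x, x ∈ cell n z → ∀ m ≤ n, cell m x = cell m z := by
    intro n z x hx m hm
    ext w
    refine ⟨fun h k hk => (h k hk).trans (hx k (by omega)), fun h k hk => (h k hk).trans (hx k (by omega)).symm⟩
  have hNeq : ∀ z x, x ∈ cell (N z) z → N x = N z := by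
    intro z x hx
    have hle : N x ≤ N z := by
      apply Nat.find_min'
      rw [hcelleq _ _ _ hx _ le_rfl]
      exact Nat.find_spec (hex z)
    apply le_antisymm hle
    apply Nat.find_min'
    rw [← hcelleq _ _ _ hx _ hle]
    exact Nat.find_spec (hex x)
  let D : Q → Set Q := fun z => cell (N z) z
  have hD : ∀ z, ∃ s ∈ U, D z ⊆ s := fun z => Nat.find_spec (hex z)
  have hDD : ∀ z x, x ∈ D z → D x = D z := by
    intro z x hx
    simp only [D]
    rw [hNeq z x hx]
    exact hcelleq _ _ _ hx _ le_rfl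
  let ch : Set Q → Set Q := fun E => if h : ∃ s ∈ U, E ⊆ s then h.choose else ∅
  have hch : ∀ z, ch (D z) ∈ U ∧ D z ⊆ ch (D z) := by
    intro z
    simp only [ch, dif_pos (hD z)]
    exact (hD z).choose_spec
  refine ⟨(fun s => {z | ch (D z) = s}) '' U, hUf.image _, ?_, ?_, ?_, ?_⟩
  · rintro _ ⟨s, hs, rfl⟩
    rw [isOpen_iff_mem_nhds]
    intro z hz
    filter_upwards [cell_open (N z) z] with x hx
    rw [hDD z x hx]
    exact hz
  · refine eq_univ_of_forall fun z => ?_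
    exact ⟨_, ⟨ch (D z), (hch z).1, rfl⟩, rfl⟩
  · rintro _ ⟨s, hs, rfl⟩
    refine ⟨s, hs, ?_⟩
    rintro z hz
    rw [mem_ofPred_eq] at hz
    rw [← hz]
    exact (hch z).2 (fun k hk => rfl)
  · intro z
    have := ((hUf.image (fun s => {z | ch (D z) = s})).subset fun s hs => hs.1 : 
      {s ∈ (fun s => {z | ch (D z) = s}) '' U | z ∈ s}.Finite).to_subtype
    refine Set.ncard_le_one_iff_subsingleton.2 ?_
    · rintro _ ⟨⟨s, hs, rfl⟩, h1⟩ _ ⟨⟨t, ht, rfl⟩, h2⟩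
      rw [mem_ofPred_eq] at h1 h2
      rw [← h1, ← h2]

noncomputable section CdCp
variable {X Y : Type*} [TopologicalSpace X] [TopologicalSpace Y]

theorem cd_nhds (f : Cp X) (s : Set (Cp X)) (hs : s ∈ 𝓝 f) :
    ∃ L : Set X, L.Finite ∧ ∃ δ > 0, ∀ f' : Cp X, (∀ a ∈ L, |f'.1 a - f.1 a| < δ) → f' ∈ s := by
  have h3 : 𝓝 f = comap (Subtype.val : {f : X → ℝ // Continuous f} → X → ℝ) (𝓝 f.1) :=
    nhds_induced _ _
  have h4 : s ∈ comap (Subtype.val : {f : X → ℝ // Continuous f} → X → ℝ) (𝓝 f.1) := h3 ▸ hs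
  obtain ⟨s', hs', hss⟩ := h4
  rw [nhds_pi, Filter.mem_pi] at hs'
  obtain ⟨L, hL, t, ht, hsub⟩ := hs'
  have : ∀ a, ∃ δ > 0, Metric.ball (f.1 a) δ ⊆ t a := fun a => Metric.mem_nhds_iff.1 (ht a)
  choose d hd hdt using this
  obtain ⟨δ, hδ, hδd⟩ : ∃ δ > 0, ∀ a ∈ L, δ ≤ d a := by
    rcases L.eq_empty_or_nonempty with rfl | hne
    · exact ⟨1, one_pos, by simp⟩
    · obtain ⟨a, ha, hmin⟩ := Set.exists_min_image L d hL hne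
      exact ⟨d a, hd a, hmin⟩
  refine ⟨L, hL, δ, hδ, fun f' hf' => hss (hsub ?_)⟩
  intro a ha
  apply hdt
  rw [Metric.mem_ball, Real.dist_eq]
  exact (hf' a ha).trans_le (hδd a ha)

theorem cd_loc {Φ : Cp X → Cp Y} (hΦ : Continuous Φ) (f : Cp X) (y : Y) (η : ℝ) (hη : 0 < η) :
    ∃ L : Set X, L.Finite ∧ ∃ δ > 0, ∀ f' : Cp X, (∀ a ∈ L, |f'.1 a - f.1 a| < δ) →
      |(Φ f').1 y - (Φ f).1 y| < η := by
  have h1 : Continuous fun f : Cp X => (Φ f).1 y :=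
    (continuous_apply y).comp (continuous_subtype_val.comp hΦ)
  have h2 : ∀ᶠ f' in 𝓝 f, |(Φ f').1 y - (Φ f).1 y| < η := by
    have := h1.continuousAt (x := f) |>.eventually (Metric.ball_mem_nhds _ hη)
    filter_upwards [this] with f' hf'
    exact hf'
  exact cd_nhds f _ h2

def cdz : Cp X := ⟨fun _ => 0, continuous_const⟩

def CdCtl (Φ : Cp X → Cp Y) (n : ℕ) (K : Set X) (y : Y) : Prop :=
  ∀ f : Cp X, (∀ a ∈ K, |f.1 a| < 1 / ((n : ℝ) + 1)) → |(Φ f).1 y - (Φ cdz).1 y| ≤ 1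

theorem cd_exists {Φ : Cp X → Cp Y} (hΦ : Continuous Φ) (y : Y) :
    ∃ n, ∃ K : Set X, K.Finite ∧ CdCtl Φ n K y := by
  obtain ⟨L, hL, δ, hδ, h⟩ := cd_loc hΦ cdz y 1 one_pos
  obtain ⟨n, hn⟩ := exists_nat_one_div_lt hδ
  refine ⟨n, L, hL, fun f hf => (h f fun a ha => ?_).le⟩
  simp only [cdz, sub_zero]
  exact (hf a ha).trans hn

theorem cd_bad {Φ : Cp X → Cp Y} (hΦ : Continuous Φ) {n : ℕ} {R : Set X} {y : Y}
    (h : ¬ CdCtl Φ n R y) : ∃ f : Cp X, (∀ a ∈ R, |f.1 a| < 1 / ((n : ℝ) + 1)) ∧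
      ∃ L : Set X, L.Finite ∧ ∀ f' : Cp X, (∀ a ∈ L, f'.1 a = f.1 a) →
        1 < |(Φ f').1 y - (Φ cdz).1 y| := by
  unfold CdCtl at h
  push Not at h
  obtain ⟨f, hf, hlt⟩ := h
  obtain ⟨L, hL, δ, hδ, h⟩ := cd_loc hΦ f y (|(Φ f).1 y - (Φ cdz).1 y| - 1) (by linarith)
  refine ⟨f, hf, L, hL, fun f' hf' => ?_⟩
  have h1 := h f' (fun a ha => by rw [hf' a ha]; simpa using hδ)
  have h2 := abs_sub_abs_le_abs_sub ((Φ f).1 y - (Φ cdz).1 y) ((Φ f').1 y - (Φ cdz).1 y)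
  rw [abs_sub_comm] at h1
  have : (Φ f).1 y - (Φ cdz).1 y - ((Φ f').1 y - (Φ cdz).1 y) = (Φ f).1 y - (Φ f').1 y := by ring
  rw [this] at h2
  linarith

theorem cd_chi {S : Type*} [TopologicalSpace S] [NormalSpace S] [T1Space S] (L W : Set S)
    (hL : L.Finite) (hW : IsOpen W) (hLW : L ⊆ W) :
    ∃ χ : C(S, ℝ), (∀ a ∈ L, χ a = 1) ∧ (∀ a ∉ W, χ a = 0) ∧ ∀ a, χ a ∈ Icc (0:ℝ) 1 := by
  obtain ⟨χ, h0, h1, h01⟩ := exists_continuous_zero_one_of_isClosed (s := Wᶜ) (t := L)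
    hW.isClosed_compl hL.isClosed (Set.disjoint_left.2 fun a ha ha' => ha (hLW ha'))
  exact ⟨χ, fun a ha => h1 ha, fun a ha => h0 ha, h01⟩

theorem cd_cut [NormalSpace X] [T1Space X] (L W : Set X)
    (hL : L.Finite) (hW : IsOpen W) (hLW : L ⊆ W) (f : Cp X) :
    ∃ f' : Cp X, (∀ a ∈ L, f'.1 a = f.1 a) ∧ (∀ a ∉ W, f'.1 a = 0) ∧ ∀ a, |f'.1 a| ≤ |f.1 a| := by
  obtain ⟨χ, h1, h0, h01⟩ := cd_chi L W hL hW hLW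
  refine ⟨⟨fun a => f.1 a * χ a, f.2.mul χ.continuous⟩, ?_, ?_, ?_⟩
  · intro a ha
    simp [h1 a ha]
  · intro a ha
    simp [h0 a ha]
  · intro a
    have := h01 a
    simp only [abs_mul]
    rw [abs_of_nonneg this.1]
    exact mul_le_of_le_one_right (abs_nonneg _) this.2

theorem cd_bump [NormalSpace Y] [T1Space Y] {Φ : Cp X → Cp Y} (hO : IsOpenMap Φ)
    {m : ℕ} (x : Fin m → X) (n : ℕ) :
    ∃ L : Set Y, L.Finite ∧ ∀ W : Set Y, IsOpen W → L ⊆ W →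
      ∃ f : Cp X, (∀ i, |f.1 (x i)| < 1 / ((n : ℝ) + 1)) ∧
        ∀ y ∉ W, 1 < |(Φ f).1 y - (Φ cdz).1 y| := by
  have ho : IsOpen {f : Cp X | ∀ i, |f.1 (x i)| < 1 / ((n : ℝ) + 1)} := by
    simp only [ofPred_forall]
    refine isOpen_iInter_of_finite fun i => isOpen_lt ?_ continuous_const
    exact ((continuous_apply (x i)).comp continuous_subtype_val).abs
  have h0 : (cdz : Cp X) ∈ {f : Cp X | ∀ i, |f.1 (x i)| < 1 / ((n : ℝ) + 1)} := by
    intro i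
    simp only [cdz, abs_zero]
    positivity
  have h2 := (hO _ ho).mem_nhds (mem_image_of_mem Φ h0)
  obtain ⟨L, hL, δ, hδ, hts⟩ := cd_nhds _ _ h2
  refine ⟨L, hL, fun W hW hLW => ?_⟩
  obtain ⟨χ, h1, h0, h01⟩ := cd_chi L W hL hW hLW
  have hg : (⟨fun y => (Φ cdz).1 y + 2 * (1 - χ y), (Φ cdz).2.add (by fun_prop)⟩ : Cp Y) ∈
      Φ '' {f : Cp X | ∀ i, |f.1 (x i)| < 1 / ((n : ℝ) + 1)} := by
    apply hts
    intro a ha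
    simpa [h1 a ha] using hδ
  obtain ⟨f, hf, hfg⟩ := hg
  refine ⟨f, hf, fun y hy => ?_⟩
  rw [hfg]
  simp [h0 y hy]

theorem cd_closed {Φ : Cp X → Cp Y} {ι : Type*} (F : Filter ι) [F.NeBot] {m n : ℕ}
    (x : ι → Fin m → X) (y : ι → Y) (x0 : Fin m → X) (y0 : Y) (hx : Tendsto x F (𝓝 x0))
    (hy : Tendsto y F (𝓝 y0)) (h : ∀ᶠ t in F, CdCtl Φ n (range (x t)) (y t)) :
    CdCtl Φ n (range x0) y0 := by
  intro f hf
  have h1 : ∀ᶠ t in F, ∀ i, |f.1 (x t i)| < 1 / ((n : ℝ) + 1) := by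
    rw [eventually_all]
    intro i
    have : Tendsto (fun t => |f.1 (x t i)|) F (𝓝 |f.1 (x0 i)|) :=
      ((f.2.tendsto _).comp (tendsto_pi_nhds.1 hx i)).abs
    exact this.eventually (gt_mem_nhds (hf _ (mem_range_self i)) : _)
  have h2 : Tendsto (fun t => |(Φ f).1 (y t) - (Φ cdz).1 (y t)|) F (𝓝 |(Φ f).1 y0 - (Φ cdz).1 y0|) :=
    ((((Φ f).2.tendsto _).comp hy).sub (((Φ cdz).2.tendsto _).comp hy)).abs
  refine le_of_tendsto h2 ?_
  filter_upwards [h, h1] with t ht ht1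
  exact ht f (by rintro _ ⟨i, rfl⟩; exact ht1 i)

/-- a map not converging along an ultrafilter eventually avoids a neighbourhood of a finite set -/
theorem cd_avoid {S ι : Type*} [TopologicalSpace S] (F : Ultrafilter ι) (u : ι → S)
    (h : ∀ a, ¬ Tendsto u F (𝓝 a)) (L : Set S) (hL : L.Finite) :
    ∃ W, IsOpen W ∧ L ⊆ W ∧ ∀ᶠ t in F, u t ∉ W := by
  have : ∀ a, ∃ W, IsOpen W ∧ a ∈ W ∧ ∀ᶠ t in F, u t ∉ W := by
    intro a
    have := h a
    rw [tendsto_def] at this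
    push Not at this
    obtain ⟨s, hs, hns⟩ := this
    obtain ⟨W, hWs, hW, haW⟩ := mem_nhds_iff.1 hs
    refine ⟨W, hW, haW, ?_⟩
    have := Ultrafilter.compl_mem_iff_notMem.2 hns
    filter_upwards [this] with t ht ht'
    exact ht (hWs ht')
  choose W hW haW hWa using this
  refine ⟨⋃ a ∈ L, W a, isOpen_biUnion fun a _ => hW a, fun a ha => mem_biUnion ha (haW a), ?_⟩
  have := (Filter.eventually_all_finite (l := (F : Filter ι)) hL).2 (fun a _ => hWa a)
  filter_upwards [this] with t ht
  simp only [mem_iUnion, not_exists]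
  exact ht

theorem cd_perfect_p [NormalSpace Y] [T1Space Y] {Φ : Cp X → Cp Y} (hO : IsOpenMap Φ)
    {ι : Type*} (F : Ultrafilter ι) {m n : ℕ}
    (x : ι → Fin m → X) (y : ι → Y) (x0 : Fin m → X) (hx : Tendsto x F (𝓝 x0))
    (h : ∀ᶠ t in F, CdCtl Φ n (range (x t)) (y t)) :
    ∃ y0, Tendsto y F (𝓝 y0) ∧ CdCtl Φ n (range x0) y0 := by
  by_cases hc : ∃ y0, Tendsto y F (𝓝 y0)
  · obtain ⟨y0, hy0⟩ := hc
    exact ⟨y0, hy0, cd_closed (F : Filter ι) x y x0 y0 hx hy0 h⟩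
  · exfalso
    push Not at hc
    obtain ⟨L, hL, hLW⟩ := cd_bump hO x0 n
    obtain ⟨W, hW, hLs, hav⟩ := cd_avoid F y hc L hL
    obtain ⟨f, hf, hfy⟩ := hLW W hW hLs
    have h1 : ∀ᶠ t in (F : Filter ι), ∀ i, |f.1 (x t i)| < 1 / ((n : ℝ) + 1) := by
      rw [eventually_all]
      intro i
      have : Tendsto (fun t => |f.1 (x t i)|) F (𝓝 |f.1 (x0 i)|) :=
        ((f.2.tendsto _).comp (tendsto_pi_nhds.1 hx i)).abs
      exact this.eventually (gt_mem_nhds (hf i) : _)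
    obtain ⟨t, ht1, ht2, ht3⟩ := (h.and (hav.and h1)).exists
    have := ht1 f (by rintro _ ⟨i, rfl⟩; exact ht3 i)
    have := hfy _ ht2
    linarith

theorem cd_fin_p [NormalSpace Y] [T1Space Y] {Φ : Cp X → Cp Y} (hO : IsOpenMap Φ)
    {m n : ℕ} (x : Fin m → X) : {y | CdCtl Φ n (range x) y}.Finite := by
  obtain ⟨L, hL, hLW⟩ := cd_bump hO x n
  refine hL.subset fun y hy => ?_
  by_contra hyL
  obtain ⟨f, hf, hfy⟩ := hLW {y}ᶜ isOpen_compl_singleton (fun a ha h => hyL (h ▸ ha))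
  have := hy f (by rintro _ ⟨i, rfl⟩; exact hf i)
  have := hfy y (by simp)
  linarith

def CdY (Φ : Cp X → Cp Y) (m n : ℕ) : Set Y :=
  {y | (∃ x : Fin m → X, CdCtl Φ n (range x) y) ∧
    ∀ K : Set X, K.Finite → K.ncard < m → ¬ CdCtl Φ n K y}

theorem cd_cover {Φ : Cp X → Cp Y} (hΦ : Continuous Φ) (y : Y) : ∃ m n, y ∈ CdY Φ m n := by
  classical
  obtain ⟨n, K, hK, h⟩ := cd_exists hΦ y
  have hex : ∃ m, ∃ K : Set X, K.Finite ∧ K.ncard = m ∧ CdCtl Φ n K y := ⟨_, K, hK, rfl, h⟩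
  obtain ⟨K', hK', hm, hC⟩ := Nat.find_spec hex
  refine ⟨Nat.find hex, n, ?_, ?_⟩
  · have : Finite K' := hK'.to_subtype
    have e : Fin (Nat.find hex) ≃ K' := (finCongr (by rw [← hm]; rfl)).trans (Finite.equivFin K').symm
    refine ⟨fun i => e i, ?_⟩
    have : range (fun i => (e i : X)) = K' := by
      ext a
      constructor
      · rintro ⟨i, rfl⟩
        exact (e i).2
      · intro ha
        exact ⟨e.symm ⟨a, ha⟩, by simp⟩
    rw [this]
    exact hC
  · intro K hK hlt hC
    exact Nat.find_min hex hlt ⟨K, hK, rfl, hC⟩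

theorem cd_ncard_lt {X : Type*} {m : ℕ} (I : Set (Fin m)) (hI : I ≠ univ) (r : Fin m → X) :
    (r '' I).ncard < m := by
  have h1 := Set.ncard_image_le (f := r) I.toFinite
  have h2 : I.ncard < (univ : Set (Fin m)).ncard :=
    Set.ncard_lt_ncard (Set.ssubset_univ_iff.2 hI) (Set.toFinite _)
  rw [Set.ncard_univ, Nat.card_eq_fintype_card, Fintype.card_fin] at h2
  omega

theorem cd_perfect_q [NormalSpace X] [T1Space X] {Φ : Cp X → Cp Y} (hΦ : Continuous Φ)
    {ι : Type*} (F : Ultrafilter ι) {m n : ℕ}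
    (x : ι → Fin m → X) (y : ι → Y) (y0 : Y) (hy0 : y0 ∈ CdY Φ m n) (hy : Tendsto y F (𝓝 y0))
    (h : ∀ᶠ t in F, CdCtl Φ n (range (x t)) (y t)) :
    ∃ x0, Tendsto x F (𝓝 x0) ∧ CdCtl Φ n (range x0) y0 := by
  classical
  set I : Set (Fin m) := {i | ∃ a, Tendsto (fun t => x t i) F (𝓝 a)} with hI
  by_cases hIu : I = univ
  · have : ∀ i, ∃ a, Tendsto (fun t => x t i) F (𝓝 a) := fun i => by
      have : i ∈ I := hIu ▸ mem_univ i
      exact this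
    choose x0 hx0 using this
    have hx0 := tendsto_pi_nhds.2 hx0
    exact ⟨x0, hx0, cd_closed (F : Filter ι) x y x0 y0 hx0 hy h⟩
  · exfalso
    have hne : ∃ t, CdCtl Φ n (range (x t)) (y t) := h.exists
    obtain ⟨t0, -⟩ := hne
    have : ∀ i, ∃ a, i ∈ I → Tendsto (fun t => x t i) F (𝓝 a) := fun i => by
      by_cases hi : i ∈ I
      · obtain ⟨a, ha⟩ := hi
        exact ⟨a, fun _ => ha⟩
      · exact ⟨x t0 i, fun h => absurd h hi⟩
    choose r hr using this
    obtain ⟨f, hf, L, hL, hbad⟩ := cd_bad hΦ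
      (hy0.2 (r '' I) (Set.toFinite _) (cd_ncard_lt I hIu r))
    have hav : ∀ i, ∃ W, IsOpen W ∧ L ⊆ W ∧ (i ∉ I → ∀ᶠ t in F, x t i ∉ W) := by
      intro i
      by_cases hi : i ∈ I
      · exact ⟨univ, isOpen_univ, subset_univ _, fun h => absurd hi h⟩
      · obtain ⟨W, h1, h2, h3⟩ := cd_avoid F (fun t => x t i) (fun a ha => hi ⟨a, ha⟩) L hL
        exact ⟨W, h1, h2, fun _ => h3⟩
    choose W hW hLW hxW using hav
    obtain ⟨f', h1, h2, h3⟩ := cd_cut L (⋂ i, W i) hL (isOpen_iInter_of_finite hW)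
      (subset_iInter hLW) f
    have hsmall : ∀ᶠ t in (F : Filter ι), ∀ i, |f'.1 (x t i)| < 1 / ((n : ℝ) + 1) := by
      rw [eventually_all]
      intro i
      by_cases hi : i ∈ I
      · have : Tendsto (fun t => |f.1 (x t i)|) F (𝓝 |f.1 (r i)|) :=
          ((f.2.tendsto _).comp (hr i hi)).abs
        filter_upwards [this.eventually (gt_mem_nhds (hf _ (mem_image_of_mem r hi)) : _)] with t ht
        exact (h3 _).trans_lt ht
      · filter_upwards [hxW i hi] with t ht
        rw [h2 _ (fun h => ht (mem_iInter.1 h i)), abs_zero]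
        positivity
    have hgt : ∀ᶠ t in (F : Filter ι), 1 < |(Φ f').1 (y t) - (Φ cdz).1 (y t)| := by
      have : Tendsto (fun t => |(Φ f').1 (y t) - (Φ cdz).1 (y t)|) F
          (𝓝 |(Φ f').1 y0 - (Φ cdz).1 y0|) :=
        ((((Φ f').2.tendsto _).comp hy).sub (((Φ cdz).2.tendsto _).comp hy)).abs
      exact this.eventually (lt_mem_nhds (hbad f' h1) : _)
    obtain ⟨t, ht1, ht2, ht3⟩ := (h.and (hsmall.and hgt)).exists
    have := ht1 f' (by rintro _ ⟨i, rfl⟩; exact ht2 i)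
    linarith

theorem cd_fin_q [NormalSpace X] [T1Space X] {Φ : Cp X → Cp Y} (hΦ : Continuous Φ)
    {m n : ℕ} (y : Y) (hy : y ∈ CdY Φ m n) :
    {x : Fin m → X | CdCtl Φ n (range x) y}.Finite := by
  classical
  by_contra hinf
  have hinf : {x : Fin m → X | CdCtl Φ n (range x) y}.Infinite := hinf
  have := hinf.cofinite_inf_principal_neBot
  obtain ⟨F, hF⟩ := Ultrafilter.exists_le
    (cofinite ⊓ 𝓟 {x : Fin m → X | CdCtl Φ n (range x) y})
  have hFc : (F : Filter (Fin m → X)) ≤ cofinite := hF.trans inf_le_left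
  have hFA : ∀ᶠ x in (F : Filter (Fin m → X)), CdCtl Φ n (range x) y :=
    (hF.trans inf_le_right) (mem_principal_self _)
  set I : Set (Fin m) := {i | ∃ a, ∀ᶠ x in (F : Filter (Fin m → X)), x i = a} with hI
  obtain ⟨x1, -⟩ := hFA.exists
  have : ∀ i, ∃ a, i ∈ I → ∀ᶠ x in (F : Filter (Fin m → X)), x i = a := fun i => by
    by_cases hi : i ∈ I
    · obtain ⟨a, ha⟩ := hi
      exact ⟨a, fun _ => ha⟩
    · exact ⟨x1 i, fun h => absurd h hi⟩
  choose r hr using this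
  have hIu : I ≠ univ := by
    intro h
    have h1 : ∀ᶠ x in (F : Filter (Fin m → X)), x = r := by
      have : ∀ᶠ x in (F : Filter (Fin m → X)), ∀ i, x i = r i := by
        rw [eventually_all]
        exact fun i => hr i (h ▸ mem_univ i)
      filter_upwards [this] with x hx using funext hx
    have h2 : ∀ᶠ x in (F : Filter (Fin m → X)), x ≠ r :=
      hFc ((Set.finite_singleton r).compl_mem_cofinite)
    obtain ⟨x, h3, h4⟩ := (h1.and h2).exists
    exact h4 h3
  obtain ⟨f, hf, L, hL, hbad⟩ := cd_bad hΦ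
    (hy.2 (r '' I) (Set.toFinite _) (cd_ncard_lt I hIu r))
  have hnL : ∀ᶠ x in (F : Filter (Fin m → X)), ∀ i, i ∉ I → x i ∉ L := by
    rw [eventually_all]
    intro i
    by_cases hi : i ∈ I
    · exact Eventually.of_forall fun x h => absurd hi h
    · have : ∀ a ∈ L, ∀ᶠ x in (F : Filter (Fin m → X)), x i ≠ a := by
        intro a _
        have : ¬ ∀ᶠ x in (F : Filter (Fin m → X)), x i = a := fun h => hi ⟨a, h⟩
        exact Ultrafilter.eventually_not.2 this
      have := (Filter.eventually_all_finite (l := (F : Filter (Fin m → X))) hL).2 this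
      filter_upwards [this] with x hx _ hxL
      exact hx _ hxL rfl
  have heq : ∀ᶠ x in (F : Filter (Fin m → X)), ∀ i, i ∈ I → x i = r i := by
    rw [eventually_all]
    intro i
    by_cases hi : i ∈ I
    · filter_upwards [hr i hi] with x hx _ using hx
    · exact Eventually.of_forall fun x h => absurd h hi
  obtain ⟨x, hx1, hx2, hx3⟩ := (hFA.and (hnL.and heq)).exists
  obtain ⟨f', h1, h2, h3⟩ := cd_cut L (x '' Iᶜ)ᶜ hL (Set.toFinite _).isClosed.isOpen_compl
    (by rintro a ha ⟨i, hi, rfl⟩; exact hx2 i hi ha) f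
  have h4 := hx1 f' (by
    rintro _ ⟨i, rfl⟩
    by_cases hi : i ∈ I
    · refine (h3 _).trans_lt ?_
      rw [hx3 i hi]
      exact hf _ (mem_image_of_mem r hi)
    · rw [h2 _ (fun h => h (mem_image_of_mem x hi)), abs_zero]
      positivity)
  have := hbad f' h1
  linarith

theorem cd_usc [NormalSpace X] [T1Space X] {Φ : Cp X → Cp Y} (hΦ : Continuous Φ)
    {m n : ℕ} (y : Y) (hy : y ∈ CdY Φ m n) (V : Set (Fin m → X)) (hV : IsOpen V)
    (hAV : ∀ x, CdCtl Φ n (range x) y → x ∈ V) :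
    ∀ᶠ y' in 𝓝 y, ∀ x : Fin m → X, CdCtl Φ n (range x) y' → x ∈ V := by
  classical
  by_contra hcon
  have hcon : ∃ᶠ y' in 𝓝 y, ∃ x : Fin m → X, CdCtl Φ n (range x) y' ∧ x ∉ V := by
    rw [Filter.not_eventually] at hcon
    refine hcon.mono fun y' h => ?_
    push Not at h
    exact h
  have hne : (𝓝 y ⊓ 𝓟 {y' | ∃ x : Fin m → X, CdCtl Φ n (range x) y' ∧ x ∉ V}).NeBot :=
    frequently_mem_iff_neBot.1 hcon
  obtain ⟨F, hF⟩ := Ultrafilter.exists_le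
    (𝓝 y ⊓ 𝓟 {y' | ∃ x : Fin m → X, CdCtl Φ n (range x) y' ∧ x ∉ V})
  have hF1 : Tendsto id (F : Filter Y) (𝓝 y) := hF.trans inf_le_left
  have hF2 : ∀ᶠ y' in (F : Filter Y), ∃ x : Fin m → X, CdCtl Φ n (range x) y' ∧ x ∉ V :=
    (hF.trans inf_le_right) (mem_principal_self _)
  obtain ⟨y1, x1, -⟩ := hF2.exists
  have : ∀ y', ∃ x : Fin m → X, (∃ x : Fin m → X, CdCtl Φ n (range x) y' ∧ x ∉ V) →
      CdCtl Φ n (range x) y' ∧ x ∉ V := by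
    intro y'
    by_cases h : ∃ x : Fin m → X, CdCtl Φ n (range x) y' ∧ x ∉ V
    · obtain ⟨x, hx⟩ := h
      exact ⟨x, fun _ => hx⟩
    · exact ⟨x1, fun h' => absurd h' h⟩
  choose x hx using this
  obtain ⟨x0, hx0, hc⟩ := cd_perfect_q hΦ F x id y hy hF1
    (hF2.mono fun y' h => (hx y' h).1)
  obtain ⟨y', h1, h2⟩ := (hF2.and (hx0.eventually (hV.mem_nhds (hAV x0 hc)))).exists
  exact (hx y' h1).2 h2

end CdCp

theorem cd_select {X Y : Type*} [TopologicalSpace X] [TopologicalSpace Y]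
    [NormalSpace X] [T1Space X] {Φ : Cp X → Cp Y} (hΦ : Continuous Φ)
    {m n : ℕ} [Nonempty (Fin m → X)] (M O : Set (Fin m → X)) (c : (Fin m → X) → (Fin m → X))
    (hM : IsClosed M) (hO : IsOpen O) (hMO : M ⊆ O)
    (hc : ∀ x ∈ O, ∀ᶠ x' in 𝓝 x, c x' = c x) (s : ℕ) (P : Set Y)
    (hP : ∀ y ∈ P, y ∈ CdY Φ m n ∧ ({x | CdCtl Φ n (range x) y} ∩ M).Nonempty ∧
      ({x | CdCtl Φ n (range x) y} ∩ M).ncard = s ∧ InjOn c ({x | CdCtl Φ n (range x) y} ∩ M)) :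
    ∃ σ : Y → Fin m → X, ∀ y ∈ P, CdCtl Φ n (range (σ y)) y ∧ ContinuousWithinAt σ P y := by
  classical
  set A : Y → Set (Fin m → X) := fun y => {x | CdCtl Φ n (range x) y} ∩ M with hA
  set vs : Y → Set (Fin m → X) := fun y => c '' A y with hvs
  have hOE : ∀ E : Set (Fin m → X), IsOpen (O ∩ {x | c x ∈ E}) := by
    intro E
    rw [isOpen_iff_mem_nhds]
    rintro x ⟨hx, hxE⟩
    filter_upwards [hO.mem_nhds hx, hc x hx] with x' h1 h2
    exact ⟨h1, by rw [mem_ofPred_eq, h2]; exact hxE⟩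
  have hfin : ∀ y ∈ P, (A y).Finite := fun y hy => (cd_fin_q hΦ y (hP y hy).1).inter_of_left _
  have hloc : ∀ y ∈ P, ∀ᶠ y' in 𝓝[P] y, vs y' = vs y := by
    intro y hy
    have h1 := cd_usc hΦ y (hP y hy).1 (Mᶜ ∪ (O ∩ {x | c x ∈ vs y}))
      (hM.isOpen_compl.union (hOE _)) (by
        intro x hx
        by_cases hxM : x ∈ M
        · exact Or.inr ⟨hMO hxM, mem_image_of_mem c ⟨hx, hxM⟩⟩
        · exact Or.inl hxM)
    filter_upwards [mem_nhdsWithin_of_mem_nhds h1, self_mem_nhdsWithin] with y' h2 hy'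
    refine Set.eq_of_subset_of_ncard_le ?_ ?_ ((hfin y hy).image c)
    · rintro _ ⟨x, ⟨hx, hxM⟩, rfl⟩
      rcases h2 x hx with h | h
      · exact absurd hxM h
      · exact h.2
    · simp only [hvs]
      rw [Set.ncard_image_of_injOn (hP y hy).2.2.2, Set.ncard_image_of_injOn (hP y' hy').2.2.2,
        (hP y hy).2.2.1, (hP y' hy').2.2.1]
  let v : Set (Fin m → X) → (Fin m → X) := fun E =>
    if h : E.Nonempty then h.some else Classical.arbitrary _
  have hv : ∀ y ∈ P, ∃ x, x ∈ A y ∧ c x = v (vs y) := by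
    intro y hy
    have hne : (vs y).Nonempty := (hP y hy).2.1.image c
    have : v (vs y) ∈ vs y := by
      simp only [v, dif_pos hne]
      exact hne.some_mem
    exact this
  choose! σ hσ hσv using hv
  refine ⟨σ, fun y hy => ⟨(hσ y hy).1, ?_⟩⟩
  rw [ContinuousWithinAt, tendsto_def]
  intro V' hV'
  obtain ⟨V, hVs, hV, hyV⟩ := mem_nhds_iff.1 hV'
  have h1 := cd_usc hΦ y (hP y hy).1 (Mᶜ ∪ (O ∩ {x | c x ∈ ({v (vs y)}ᶜ : Set _)}) ∪ V)
      ((hM.isOpen_compl.union (hOE _)).union hV) (by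
        intro x hx
        by_cases hxM : x ∈ M
        · by_cases hcx : c x = v (vs y)
          · right
            have : x = σ y := (hP y hy).2.2.2 ⟨hx, hxM⟩ (hσ y hy) (hcx.trans (hσv y hy).symm)
            rw [this]
            exact hyV
          · exact Or.inl (Or.inr ⟨hMO hxM, hcx⟩)
        · exact Or.inl (Or.inl hxM))
  filter_upwards [mem_nhdsWithin_of_mem_nhds h1, hloc y hy, self_mem_nhdsWithin] with y' h2 h3 hy'
  rcases h2 (σ y') (hσ y' hy').1 with (h | h) | h
  · exact absurd (hσ y' hy').2 h
  · exact absurd ((hσv y' hy').trans (by rw [h3])) h.2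
  · exact hVs h

theorem cd_Q {X Y : Type*} [TopologicalSpace X] [MetricSpace Y]
    {Φ : Cp X → Cp Y} (hO : IsOpenMap Φ) {m n : ℕ} (P : Set Y) (σ : Y → Fin m → X)
    (hσ : ∀ y ∈ P, CdCtl Φ n (range (σ y)) y ∧ ContinuousWithinAt σ P y)
    {T β : Type*} (ZX : β → Set X) (hZ : ∀ b, CdZD T (ZX b)) (a : Fin m → β)
    (M : Set Y) (c : Y → Y) (ε : ℝ)
    (hc : ∀ y ∈ M, dist y (c y) < ε ∧ ∀ᶠ y' in 𝓝 y, c y' = c y) :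
    CdZD ((Fin m → T) × Y) {y | y ∈ P ∧ (∀ i, σ y i ∈ ZX (a i)) ∧ y ∈ M ∧
      ∀ y', CdCtl Φ n (range (σ y)) y' → y' ≠ y → 2 * ε < dist y y'} := by
  classical
  choose g hg1 hg2 using hZ
  set Q : Set Y := {y | y ∈ P ∧ (∀ i, σ y i ∈ ZX (a i)) ∧ y ∈ M ∧
      ∀ y', CdCtl Φ n (range (σ y)) y' → y' ≠ y → 2 * ε < dist y y'} with hQ
  refine ⟨fun k y => (fun i => g (a i) k (σ y i), c y), ?_, ?_⟩
  · intro k y hy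
    have h1 : ∀ᶠ y' in 𝓝[Q] y, ∀ i, g (a i) k (σ y' i) = g (a i) k (σ y i) := by
      rw [eventually_all]
      intro i
      have hcont : Tendsto (fun y' => σ y' i) (𝓝[Q] y) (𝓝[ZX (a i)] (σ y i)) := by
        rw [tendsto_nhdsWithin_iff]
        refine ⟨tendsto_pi_nhds.1 ((hσ y hy.1).2.mono fun y' h => h.1) i, ?_⟩
        filter_upwards [self_mem_nhdsWithin] with y' hy' using hy'.2.1 i
      exact hcont.eventually (hg1 (a i) k _ (hy.2.1 i))
    filter_upwards [h1, mem_nhdsWithin_of_mem_nhds (hc y hy.2.2.1).2] with y' h1 h2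
    exact Prod.ext (funext h1) h2
  · intro y hy U hU
    by_contra hcon
    push Not at hcon
    choose u huQ hug huU using hcon
    let F : Ultrafilter ℕ := hyperfilter ℕ
    have hFle : (F : Filter ℕ) ≤ atTop := by
      rw [← Nat.cofinite_eq_atTop]; exact hyperfilter_le_cofinite
    have hx : Tendsto (fun N => σ (u N)) F (𝓝 (σ y)) := by
      rw [tendsto_pi_nhds]
      intro i
      rw [tendsto_def]
      intro V hV
      obtain ⟨N, hN⟩ := hg2 (a i) _ (hy.2.1 i) V hV
      apply hFle
      filter_upwards [eventually_ge_atTop N] with t ht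
      refine hN _ ((huQ t).2.1 i) fun k hk => ?_
      exact congrFun (congrArg Prod.fst (hug t k (by omega))) i
    obtain ⟨y0, hy0, hC⟩ := cd_perfect_p hO F (fun N => σ (u N)) u (σ y) hx
      (Eventually.of_forall fun N => (hσ _ (huQ N).1).1)
    have hd : dist y y0 ≤ 2 * ε := by
      have ht : Tendsto (fun N => dist y (u N)) F (𝓝 (dist y y0)) := tendsto_const_nhds.dist hy0
      refine le_of_tendsto ht ?_
      apply hFle
      filter_upwards [eventually_ge_atTop 1] with t ht
      have h1 : c (u t) = c y := congrArg Prod.snd (hug t 0 (by omega))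
      have h2 := (hc _ (huQ t).2.2.1).1
      have h3 := (hc _ hy.2.2.1).1
      rw [h1] at h2
      have := dist_triangle y (c y) (u t)
      rw [dist_comm (c y) (u t)] at this
      linarith
    have heq : y0 = y := by
      by_contra hne
      have := hy.2.2.2 y0 hC hne
      linarith
    rw [heq] at hy0
    obtain ⟨t, ht⟩ := (hy0.eventually hU).exists
    exact huU t ht

def CdGood {Y : Type*} [TopologicalSpace Y] (A : Set Y) : Prop :=
  ∃ S : ℕ → Set Y, A ⊆ ⋃ i, S i ∧ ∀ i, CovDimLE ↥(S i) 0

theorem cd_good_of_zd {Y : Type*} [TopologicalSpace Y] {T : Type*} {Q : Set Y} (h : CdZD T Q) :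
    CdGood Q :=
  ⟨fun _ => Q, subset_iUnion (fun _ : ℕ => Q) 0, fun _ => cd_zd_dim Q h⟩

theorem cd_good_iUnion {Y : Type*} [TopologicalSpace Y] {ι : Type*} [Countable ι] [Nonempty ι]
    (A : ι → Set Y) (B : Set Y) (hB : ∀ y ∈ B, ∃ i, y ∈ A i) (h : ∀ i, CdGood (A i)) :
    CdGood B := by
  choose S hS hd using h
  obtain ⟨e, he⟩ := exists_surjective_nat ι
  refine ⟨fun t => S (e t.unpair.1) t.unpair.2, ?_, fun t => hd _ _⟩
  intro y hy
  obtain ⟨i, hi⟩ := hB y hy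
  obtain ⟨r, rfl⟩ := he i
  obtain ⟨k, hk⟩ := mem_iUnion.1 (hS _ hi)
  exact mem_iUnion.2 ⟨Nat.pair r k, by simpa using hk⟩

theorem cd_sep {S : Type*} [MetricSpace S] (A : Set S) (hA : A.Finite) :
    ∃ k : ℕ, ∀ x ∈ A, ∀ y ∈ A, y ≠ x → 2 * (1 / ((k : ℝ) + 1)) < dist x y := by
  have hf : ((A ×ˢ A) ∩ {p : S × S | p.2 ≠ p.1}).Finite := (hA.prod hA).inter_of_left _
  rcases ((A ×ˢ A) ∩ {p : S × S | p.2 ≠ p.1}).eq_empty_or_nonempty with he | hne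
  · refine ⟨0, fun x hx y hy hxy => ?_⟩
    have : (x, y) ∈ (A ×ˢ A) ∩ {p : S × S | p.2 ≠ p.1} := ⟨⟨hx, hy⟩, hxy⟩
    rw [he] at this
    exact absurd this (notMem_empty _)
  · obtain ⟨p, hp, hmin⟩ := Set.exists_min_image _ (fun p : S × S => dist p.1 p.2) hf hne
    have hpos : 0 < dist p.1 p.2 := dist_pos.2 (Ne.symm hp.2)
    obtain ⟨k, hk⟩ := exists_nat_one_div_lt (half_pos hpos)
    refine ⟨k, fun x hx y hy hxy => ?_⟩
    have := hmin (x, y) ⟨⟨hx, hy⟩, hxy⟩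
    simp only at this
    linarith

theorem cd_main {X Y : Type*} [MetricSpace X] [MetricSpace Y]
    (Φ : Cp X → Cp Y) (hΦ : Continuous Φ) (hO : IsOpenMap Φ)
    {T β : Type*} [Countable β] [Nonempty β] (ZX : β → Set X) (hZ : ∀ b, CdZD T (ZX b))
    (hcovX : ∀ x, ∃ b, x ∈ ZX b) : CdGood (univ : Set Y) := by
  classical
  refine cd_good_iUnion (ι := ℕ × ℕ) (fun p => CdY Φ p.1 p.2) _
    (fun y _ => by obtain ⟨m, n, h⟩ := cd_cover hΦ y; exact ⟨(m, n), h⟩) ?_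
  rintro ⟨m, n⟩
  choose M O c hM hOo hMO hcov hc using
    fun k : ℕ => cd_sig (Fin m → X) (1 / ((k : ℝ) + 1)) (by positivity)
  choose M' O' c' hM' hOo' hMO' hcov' hc' using
    fun k : ℕ => cd_sig Y (1 / ((k : ℝ) + 1)) (by positivity)
  refine cd_good_iUnion (ι := ℕ × ℕ × ℕ) (fun q => {y | y ∈ CdY Φ m n ∧
      ({x | CdCtl Φ n (range x) y} ∩ M q.1 q.2.1).Nonempty ∧
      ({x | CdCtl Φ n (range x) y} ∩ M q.1 q.2.1).ncard = q.2.2 ∧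
      InjOn (c q.1 q.2.1) ({x | CdCtl Φ n (range x) y} ∩ M q.1 q.2.1)}) _ ?_ ?_
  · intro y hy
    obtain ⟨k, hk⟩ := cd_sep _ (cd_fin_q hΦ y hy)
    obtain ⟨x, hx⟩ := hy.1
    obtain ⟨j, hj⟩ := hcov k x
    refine ⟨(k, j, ({x : Fin m → X | CdCtl Φ n (range x) y} ∩ M k j).ncard), hy, ⟨x, hx, hj⟩, rfl, ?_⟩
    rintro x1 ⟨hx1, hm1⟩ x2 ⟨hx2, hm2⟩ h12
    by_contra hne
    have h0 := hk x1 hx1 x2 hx2 (Ne.symm hne)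
    have h1 := (hc k j x1 (hMO k j hm1)).1
    have h2 := (hc k j x2 (hMO k j hm2)).1
    simp only at h12
    rw [← h12] at h2
    have := dist_triangle x1 (c k j x1) x2
    rw [dist_comm (c k j x1) x2] at this
    linarith
  · rintro ⟨k, j, s⟩
    dsimp only
    set P : Set Y := {y | y ∈ CdY Φ m n ∧
      ({x | CdCtl Φ n (range x) y} ∩ M k j).Nonempty ∧
      ({x | CdCtl Φ n (range x) y} ∩ M k j).ncard = s ∧
      InjOn (c k j) ({x | CdCtl Φ n (range x) y} ∩ M k j)} with hP
    rcases P.eq_empty_or_nonempty with he | ⟨y1, hy1⟩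
    · rw [he]
      refine cd_good_of_zd (T := Y) ⟨fun _ y => y, ?_, ?_⟩ <;> simp
    have : Nonempty (Fin m → X) := ⟨hy1.2.1.some⟩
    obtain ⟨σ, hσ⟩ := cd_select hΦ (n := n) (M k j) (O k j) (c k j) (hM k j) (hOo k j) (hMO k j)
      (fun x hx => (hc k j x hx).2) s P (fun y hy => hy)
    refine cd_good_iUnion (ι := (Fin m → β) × ℕ × ℕ) (fun q => {y | y ∈ P ∧
      (∀ i, σ y i ∈ ZX (q.1 i)) ∧ y ∈ M' q.2.1 q.2.2 ∧
      ∀ y', CdCtl Φ n (range (σ y)) y' → y' ≠ y → 2 * (1 / ((q.2.1 : ℝ) + 1)) < dist y y'}) _ ?_ ?_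
    · intro y hy
      obtain ⟨k', hk'⟩ := cd_sep _ (cd_fin_p hO (n := n) (σ y))
      obtain ⟨j', hj'⟩ := hcov' k' y
      choose a ha using fun i => hcovX (σ y i)
      exact ⟨(a, k', j'), hy, ha, hj', fun y' hy' hne => hk' y (hσ y hy).1 y' hy' hne⟩
    · rintro ⟨a, k', j'⟩
      exact cd_good_of_zd (cd_Q hO P σ hσ ZX hZ a (M' k' j') (c' k' j') _
        (fun y hy => hc' k' j' y (hMO' k' j' hy)))

end CdHelpers

open Set in
/-- If `X`, `Y` are metrizable spaces, `C_p(Y)` is the image of `C_p(X)` under a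
continuous open mapping, and `X` is countable-dimensional, then so is `Y`. -/
theorem countable_dimensional_preserved {X Y : Type*}
    [TopologicalSpace X] [TopologicalSpace.MetrizableSpace X]
    [TopologicalSpace Y] [TopologicalSpace.MetrizableSpace Y]
    (hΦ : ∃ Φ : Cp X → Cp Y, Continuous Φ ∧ IsOpenMap Φ ∧ Function.Surjective Φ)
    (hX : CountableDimensional X) : CountableDimensional Y := by
  classical
  letI := TopologicalSpace.metrizableSpaceMetric X
  letI := TopologicalSpace.metrizableSpaceMetric Y
  obtain ⟨Φ, hΦ, hO, -⟩ := hΦ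
  obtain ⟨S, hS, hd⟩ := hX
  choose n hn using hd
  choose Z hZc hZ using fun i => cd_decomp (hn i)
  obtain ⟨S', h1, h2⟩ := cd_main Φ hΦ hO
    (fun b : ℕ × Finset ℕ => Subtype.val '' Z b.1 b.2)
    (fun b => cd_zd_image _ _ (hZ b.1 b.2)) (by
      intro x
      have hx : x ∈ ⋃ i, S i := by rw [hS]; trivial
      obtain ⟨i, hi⟩ := mem_iUnion.1 hx
      obtain ⟨F, hF⟩ := hZc i ⟨x, hi⟩
      exact ⟨(i, F), ⟨x, hi⟩, hF, rfl⟩)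
  exact ⟨S', univ_subset_iff.1 h1, fun i => ⟨0, h2 i⟩⟩
end

section
/- Let X and Y be metrizable spaces that are t-equivalent, i.e., C_p(X) and C_p(Y) are homeomorphic. Then X is countable-dimensional if and only if Y is countable-dimensional. -/
namespace TInv
open Set Filter Topology

def DimLE {Z : Type*} [TopologicalSpace Z] (M : Set Z) (n : ℕ) : Prop :=
  ∀ (k : ℕ) (U : Fin k → Set Z), (∀ j, IsOpen (U j)) → M ⊆ ⋃ j, U j →
    ∃ W : Fin k → Set Z, (∀ j, IsOpen (W j)) ∧ (∀ j, W j ⊆ U j) ∧ M ⊆ ⋃ j, W j ∧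
      ∀ z ∈ M, {j | z ∈ W j}.ncard ≤ n + 1

theorem DimLE.mono_n {Z : Type*} [TopologicalSpace Z] {M : Set Z} {n n' : ℕ} (h : DimLE M n)
    (hn : n ≤ n') : DimLE M n' := by
  intro k U hU hM
  obtain ⟨W, h1, h2, h3, h4⟩ := h k U hU hM
  exact ⟨W, h1, h2, h3, fun z hz => (h4 z hz).trans (by omega)⟩

theorem dimLE_empty {Z : Type*} [TopologicalSpace Z] (n : ℕ) : DimLE (∅ : Set Z) n := by
  intro k U hU hM
  exact ⟨U, hU, fun _ => Subset.rfl, hM, fun z hz => hz.elim⟩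

theorem dimLE_of_cov {Z : Type*} [TopologicalSpace Z] {M : Set Z} {n : ℕ}
    (h : CovDimLE ↥M n) : DimLE M n := by
  classical
  intro k U hU hM
  obtain ⟨V, hVf, hVo, hVc, hVr, hVn⟩ := h (range fun j => (Subtype.val ⁻¹' U j : Set M))
    (finite_range _) (by rintro _ ⟨j, rfl⟩; exact (hU j).preimage continuous_subtype_val)
    (by
      rw [sUnion_range, ← preimage_iUnion]
      exact eq_univ_of_forall fun z => hM z.2)
  have hr : ∀ s : V, ∃ j, (s : Set M) ⊆ Subtype.val ⁻¹' U j := by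
    rintro ⟨s, hs⟩
    obtain ⟨_, ⟨j, rfl⟩, h⟩ := hVr s hs
    exact ⟨j, h⟩
  choose J hJ using hr
  have ho : ∀ s : V, ∃ O : Set Z, IsOpen O ∧ Subtype.val ⁻¹' O = (s : Set M) := fun s =>
    isOpen_induced_iff.1 (hVo s s.2)
  choose O hO hOs using ho
  refine ⟨fun j => ⋃ s : V, ⋃ _ : J s = j, O s ∩ U j, ?_, ?_, ?_, ?_⟩
  · intro j
    exact isOpen_iUnion fun s => isOpen_iUnion fun _ => (hO s).inter (hU j)
  · intro j
    exact iUnion_subset fun s => iUnion_subset fun _ => inter_subset_right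
  · intro z hz
    have : (⟨z, hz⟩ : M) ∈ ⋃₀ V := by rw [hVc]; trivial
    obtain ⟨s, hs, hzs⟩ := this
    have h1 := hJ ⟨s, hs⟩ hzs
    have h2 : (⟨z, hz⟩ : M) ∈ Subtype.val ⁻¹' O ⟨s, hs⟩ := by rw [hOs]; exact hzs
    simp only [mem_iUnion]
    exact ⟨_, ⟨s, hs⟩, rfl, h2, h1⟩
  · intro z hz
    refine le_trans ?_ (hVn ⟨z, hz⟩)
    have : {j | z ∈ ⋃ s : V, ⋃ _ : J s = j, O s ∩ U j} ⊆
        (fun s => if hs : s ∈ V then J ⟨s, hs⟩ else J (Classical.choice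
          (by
            have : (⟨z, hz⟩ : M) ∈ ⋃₀ V := by rw [hVc]; trivial
            obtain ⟨s, hs, hzs⟩ := this
            exact ⟨⟨s, hs⟩⟩))) '' {s ∈ V | (⟨z, hz⟩ : M) ∈ s} := by
      intro j hj
      simp only [mem_ofPred_eq, mem_iUnion] at hj
      obtain ⟨s, hs, hz1, hz2⟩ := hj
      refine ⟨s, ⟨s.2, ?_⟩, ?_⟩
      · rw [← hOs]; exact hz1
      · simp [hs]
    have hfin : {s ∈ V | (⟨z, hz⟩ : M) ∈ s}.Finite := hVf.subset fun s hs => hs.1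
    exact (ncard_le_ncard this (hfin.image _)).trans (ncard_image_le hfin)

theorem cov_of_dimLE {Z : Type*} [TopologicalSpace Z] {M : Set Z} {n : ℕ}
    (h : DimLE M n) : CovDimLE ↥M n := by
  intro U hUf hUo hUc
  obtain ⟨k, u, hu⟩ := hUf.fin_embedding
  have ho : ∀ j, ∃ O : Set Z, IsOpen O ∧ Subtype.val ⁻¹' O = (u j : Set M) := fun j =>
    isOpen_induced_iff.1 (hUo _ (by rw [← hu]; exact mem_range_self j))
  choose O hO hOs using ho
  obtain ⟨W, h1, h2, h3, h4⟩ := h k O hO (by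
    intro z hz
    have : (⟨z, hz⟩ : M) ∈ ⋃₀ U := by rw [hUc]; trivial
    rw [← hu] at this
    obtain ⟨_, ⟨j, rfl⟩, hj⟩ := this
    rw [← hOs] at hj
    exact mem_iUnion.2 ⟨j, hj⟩)
  refine ⟨range fun j => (Subtype.val ⁻¹' W j : Set M), finite_range _, ?_, ?_, ?_, ?_⟩
  · rintro _ ⟨j, rfl⟩
    exact (h1 j).preimage continuous_subtype_val
  · rw [sUnion_range, ← preimage_iUnion]
    exact eq_univ_of_forall fun z => h3 z.2
  · rintro _ ⟨j, rfl⟩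
    refine ⟨u j, by rw [← hu]; exact mem_range_self j, ?_⟩
    rw [← hOs]
    exact preimage_mono (h2 j)
  · intro z
    refine le_trans ?_ (h4 z z.2)
    have : {s ∈ range fun j => (Subtype.val ⁻¹' W j : Set M) | z ∈ s} ⊆
        (fun j => (Subtype.val ⁻¹' W j : Set M)) '' {j | (z : Z) ∈ W j} := by
      rintro _ ⟨⟨j, rfl⟩, hz⟩
      exact ⟨j, hz, rfl⟩
    exact (ncard_le_ncard this ((toFinite _).image _)).trans (ncard_image_le (toFinite _))

theorem exists_fn {Z : Type*} [TopologicalSpace Z] [TopologicalSpace.MetrizableSpace Z]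
    {O : Set Z} (hO : IsOpen O) : ∃ g : Z → ℝ, Continuous g ∧ (∀ z, 0 ≤ g z) ∧
      ∀ z, z ∈ O ↔ 0 < g z := by
  let _ := TopologicalSpace.metrizableSpaceMetric Z
  rcases (Oᶜ).eq_empty_or_nonempty with h | h
  · refine ⟨fun _ => 1, continuous_const, fun _ => zero_le_one, fun z => ?_⟩
    rw [compl_empty_iff] at h
    simp [h]
  · refine ⟨fun z => Metric.infDist z Oᶜ, Metric.continuous_infDist_pt _,
      fun _ => Metric.infDist_nonneg, fun z => ?_⟩
    rw [← hO.isClosed_compl.notMem_iff_infDist_pos h]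
    simp

theorem DimLE.subset {Z : Type*} [TopologicalSpace Z] [TopologicalSpace.MetrizableSpace Z]
    {S M : Set Z} {n : ℕ} (h : DimLE S n) (hMS : M ⊆ S) : DimLE M (2 * n + 1) := by
  intro k U hU hM
  obtain ⟨g, hg, hg0, hgO⟩ := exists_fn (isOpen_iUnion hU)
  have key : ∀ i : ℕ, ∃ W : Fin (k+1) → Set Z, (∀ j, IsOpen (W j)) ∧
      (∀ j, W j ⊆ (Fin.cons {z | (i : ℝ) * g z ≤ 1 ∧ 1 ≤ (i+1) * g z}ᶜ U : Fin (k+1) → Set Z) j) ∧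
      S ⊆ ⋃ j, W j ∧ ∀ z ∈ S, {j | z ∈ W j}.ncard ≤ n + 1 := by
    intro i
    apply h
    · intro j
      refine Fin.cases ?_ (fun j => ?_) j
      · simp only [Fin.cons_zero, isOpen_compl_iff]
        have e1 : IsClosed {z | (i : ℝ) * g z ≤ 1} := isClosed_le (by fun_prop) (by fun_prop)
        have e2 : IsClosed {z | 1 ≤ ((i : ℝ) + 1) * g z} := isClosed_le (by fun_prop) (by fun_prop)
        exact e1.inter e2
      · simpa using hU j
    · intro z _
      by_cases hz : (i : ℝ) * g z ≤ 1 ∧ 1 ≤ (i+1) * g z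
      · have : z ∈ ⋃ j, U j := by
          rw [hgO]
          rcases (hg0 z).eq_or_lt with h0 | h0
          · rw [← h0] at hz; norm_num at hz
          · exact h0
        obtain ⟨j, hj⟩ := mem_iUnion.1 this
        exact mem_iUnion.2 ⟨j.succ, by simpa using hj⟩
      · exact mem_iUnion.2 ⟨0, by simpa using hz⟩
  choose W h1 h2 h3 h4 using key
  set N : ℕ → Set Z := fun i => {z | ((i : ℝ) - 1/2) * g z < 1 ∧ 1 < (i + 3/2) * g z} with hN
  have hNo : ∀ i, IsOpen (N i) := fun i => by
    have e1 : IsOpen {z | ((i : ℝ) - 1/2) * g z < 1} := isOpen_lt (by fun_prop) (by fun_prop)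
    have e2 : IsOpen {z | 1 < ((i : ℝ) + 3/2) * g z} := isOpen_lt (by fun_prop) (by fun_prop)
    exact e1.inter e2
  have hNN : ∀ z i i', z ∈ N i → z ∈ N i' → i' < i + 2 := by
    intro z i i' hi hi'
    by_contra hlt
    have hc : (i : ℝ) + 2 ≤ i' := by exact_mod_cast (not_lt.1 hlt)
    have := hi.2
    have := hi'.1
    nlinarith [hg0 z]
  refine ⟨fun j => ⋃ i, W i j.succ ∩ N i, ?_, ?_, ?_, ?_⟩
  · exact fun j => isOpen_iUnion fun i => (h1 i _).inter (hNo i)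
  · refine fun j => iUnion_subset fun i => inter_subset_left.trans ?_
    simpa using h2 i j.succ
  · intro z hz
    have hpos := (hgO z).1 (hM hz)
    set i := ⌊1 / g z⌋₊ with hi
    have hi1 : (i : ℝ) * g z ≤ 1 := by
      have := Nat.floor_le (a := 1 / g z) (by positivity)
      rwa [← hi, le_div_iff₀ hpos] at this
    have hi2 : 1 < ((i : ℝ) + 1) * g z := by
      have := Nat.lt_floor_add_one (1 / g z)
      rwa [← hi, div_lt_iff₀ hpos] at this
    obtain ⟨j, hj⟩ := mem_iUnion.1 (h3 i (hMS hz))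
    revert hj
    refine Fin.cases (fun hj => ?_) (fun j hj => ?_) j
    · have := h2 i 0 hj
      simp only [Fin.cons_zero] at this
      exact (this ⟨hi1, hi2.le⟩).elim
    · simp only [mem_iUnion]
      exact ⟨j, i, hj, by nlinarith, by nlinarith⟩
  · intro z hz
    by_cases hex : ∃ i, z ∈ N i
    · classical
      set i := Nat.find hex with hi
      have hi1 : z ∈ N i := Nat.find_spec hex
      have hsub : {j : Fin k | z ∈ ⋃ i, W i j.succ ∩ N i} ⊆
          {j | z ∈ W i j.succ} ∪ {j | z ∈ W (i+1) j.succ} := by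
        intro j hj
        simp only [mem_ofPred_eq, mem_iUnion] at hj
        obtain ⟨i', hj', hN'⟩ := hj
        have a := hNN z i i' hi1 hN'
        have b : i ≤ i' := Nat.find_min' hex hN'
        rcases (by omega : i' = i ∨ i' = i + 1) with rfl | rfl
        · exact Or.inl hj'
        · exact Or.inr hj'
      have hc : ∀ i, {j : Fin k | z ∈ W i j.succ}.ncard ≤ n + 1 := by
        intro i
        refine le_trans ?_ (h4 i z (hMS hz))
        rw [← ncard_image_of_injective _ (Fin.succ_injective k)]
        refine ncard_le_ncard ?_ (toFinite _)
        rintro _ ⟨j, hj, rfl⟩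
        exact hj
      have := ncard_le_ncard hsub (toFinite _)
      have := ncard_union_le {j : Fin k | z ∈ W i j.succ} {j | z ∈ W (i+1) j.succ}
      have := hc i
      have := hc (i+1)
      beta_reduce
      omega
    · have : {j : Fin k | z ∈ ⋃ i, W i j.succ ∩ N i} = ∅ := by
        ext j
        simp only [mem_ofPred_eq, mem_iUnion, mem_empty_iff_false, iff_false]
        rintro ⟨i, _, hi⟩
        exact hex ⟨i, hi⟩
      rw [this]; simp

theorem DimLE.transfer {X Y : Type*} [TopologicalSpace X] [TopologicalSpace Y]
    {P : Set Y} {f : P → X} (hf : IsInducing f) {S : Set X} {n : ℕ} (h : DimLE S n)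
    (hS : S ⊆ range f) : DimLE (Subtype.val '' (f ⁻¹' S)) n := by
  intro k U hU hM
  have ho : ∀ j, ∃ O : Set X, IsOpen O ∧ f ⁻¹' O = (Subtype.val ⁻¹' U j : Set P) := fun j =>
    hf.isOpen_iff.1 ((hU j).preimage continuous_subtype_val)
  choose O hO hOs using ho
  obtain ⟨W, h1, h2, h3, h4⟩ := h k O hO (by
    intro x hx
    obtain ⟨y, rfl⟩ := hS hx
    obtain ⟨j, hj⟩ := mem_iUnion.1 (hM ⟨y, hx, rfl⟩)
    refine mem_iUnion.2 ⟨j, ?_⟩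
    change y ∈ f ⁻¹' O j
    rw [hOs]; exact hj)
  have ho' : ∀ j, ∃ O' : Set Y, IsOpen O' ∧ Subtype.val ⁻¹' O' = f ⁻¹' W j := fun j =>
    isOpen_induced_iff.1 ((h1 j).preimage hf.continuous)
  choose O' hO' hOs' using ho'
  refine ⟨fun j => O' j ∩ U j, fun j => (hO' j).inter (hU j), fun j => inter_subset_right, ?_, ?_⟩
  · rintro _ ⟨y, hy, rfl⟩
    obtain ⟨j, hj⟩ := mem_iUnion.1 (h3 hy)
    refine mem_iUnion.2 ⟨j, ?_, ?_⟩
    · change y ∈ Subtype.val ⁻¹' O' j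
      rw [hOs']; exact hj
    · change y ∈ (Subtype.val ⁻¹' U j : Set P)
      rw [← hOs]; exact h2 j hj
  · rintro _ ⟨y, hy, rfl⟩
    refine le_trans (ncard_le_ncard ?_ (toFinite _)) (h4 _ hy)
    rintro j ⟨hj, _⟩
    change y ∈ Subtype.val ⁻¹' O' j at hj
    rw [hOs'] at hj; exact hj

theorem dimLE_disjoint {Z ι : Type*} [TopologicalSpace Z] {M : Set Z} {n : ℕ} (V : ι → Set Z)
    (hV : ∀ s, IsOpen (V s)) (hM : M ⊆ ⋃ s, V s)
    (hu : ∀ z ∈ M, ∀ s s', z ∈ V s → z ∈ V s' → s = s')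
    (h : ∀ s, DimLE (M ∩ V s) n) : DimLE M n := by
  intro k U hU hMU
  choose W h1 h2 h3 h4 using fun s => h s k U hU (inter_subset_left.trans hMU)
  refine ⟨fun j => ⋃ s, W s j ∩ V s, fun j => isOpen_iUnion fun s => (h1 s j).inter (hV s),
    fun j => iUnion_subset fun s => inter_subset_left.trans (h2 s j), ?_, ?_⟩
  · intro z hz
    obtain ⟨s, hs⟩ := mem_iUnion.1 (hM hz)
    obtain ⟨j, hj⟩ := mem_iUnion.1 (h3 s ⟨hz, hs⟩)
    simp only [mem_iUnion]
    exact ⟨j, s, hj, hs⟩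
  · intro z hz
    obtain ⟨s, hs⟩ := mem_iUnion.1 (hM hz)
    refine le_trans (ncard_le_ncard ?_ (toFinite _)) (h4 s z ⟨hz, hs⟩)
    intro j hj
    simp only [mem_ofPred_eq, mem_iUnion] at hj
    obtain ⟨s', hj', hs'⟩ := hj
    rw [hu z hz s s' hs hs']
    exact hj'

def CDS {Z : Type*} [TopologicalSpace Z] (M : Set Z) : Prop :=
  ∃ S : ℕ → Set Z, M ⊆ ⋃ i, S i ∧ ∀ i, ∃ n : ℕ, DimLE (S i) n

theorem cd_iff {Z : Type*} [TopologicalSpace Z] :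
    CountableDimensional Z ↔ CDS (univ : Set Z) := by
  constructor
  · rintro ⟨S, h1, h2⟩
    exact ⟨S, h1.ge, fun i => (h2 i).imp fun n hn => dimLE_of_cov hn⟩
  · rintro ⟨S, h1, h2⟩
    exact ⟨S, univ_subset_iff.1 h1, fun i => (h2 i).imp fun n hn => cov_of_dimLE hn⟩

theorem CDS.mono {Z : Type*} [TopologicalSpace Z] {M M' : Set Z} (h : CDS M) (hs : M' ⊆ M) :
    CDS M' := by
  obtain ⟨S, h1, h2⟩ := h
  exact ⟨S, hs.trans h1, h2⟩

theorem cds_empty {Z : Type*} [TopologicalSpace Z] : CDS (∅ : Set Z) :=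
  ⟨fun _ => ∅, by simp, fun _ => ⟨0, dimLE_empty 0⟩⟩

theorem cds_of_countable {Z ι : Type*} [TopologicalSpace Z] [Countable ι] {M : Set Z}
    (S : ι → Set Z) (hM : M ⊆ ⋃ i, S i) (h : ∀ i, ∃ n, DimLE (S i) n) : CDS M := by
  rcases isEmpty_or_nonempty ι with hι | hι
  · exact cds_empty.mono (by simpa using hM)
  · obtain ⟨e, he⟩ := exists_surjective_nat ι
    refine ⟨fun i => S (e i), ?_, fun i => h _⟩
    rwa [he.iUnion_comp]

theorem cds_iUnion {Z ι : Type*} [TopologicalSpace Z] [Countable ι] {M : ι → Set Z}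
    (h : ∀ i, CDS (M i)) : CDS (⋃ i, M i) := by
  choose S h1 h2 using h
  refine cds_of_countable (fun p : ι × ℕ => S p.1 p.2) ?_ fun p => h2 _ _
  refine iUnion_subset fun i => (h1 i).trans ?_
  exact iUnion_subset fun j => subset_iUnion (fun p : ι × ℕ => S p.1 p.2) (i, j)

theorem cds_transfer {X Y : Type*} [TopologicalSpace X] [TopologicalSpace.MetrizableSpace X]
    [TopologicalSpace Y] (hX : CDS (univ : Set X))
    {P : Set Y} {f : P → X} (hf : IsInducing f) : CDS P := by
  obtain ⟨S, h1, h2⟩ := hX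
  refine ⟨fun i => Subtype.val '' (f ⁻¹' (S i ∩ range f)), ?_, fun i => ?_⟩
  · intro y hy
    obtain ⟨i, hi⟩ := mem_iUnion.1 (h1 (mem_univ (f ⟨y, hy⟩)))
    exact mem_iUnion.2 ⟨i, ⟨y, hy⟩, ⟨hi, mem_range_self _⟩, rfl⟩
  · obtain ⟨n, hn⟩ := h2 i
    exact ⟨_, (hn.subset inter_subset_left).transfer hf inter_subset_right⟩

theorem cds_local {Z : Type*} [TopologicalSpace Z] [TopologicalSpace.MetrizableSpace Z]
    {T : Set Z} (h : ∀ z ∈ T, ∃ N, IsOpen N ∧ z ∈ N ∧ CDS (T ∩ N)) : CDS T := by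
  classical
  choose N hNo hzN hN using fun z : T => h z z.2
  have hOo : IsOpen (⋃ z, N z) := isOpen_iUnion hNo
  let _ := TopologicalSpace.metrizableSpaceMetric Z
  obtain ⟨v, hvo, hvc, hvf, hvN⟩ := precise_refinement
    (fun z : T => (Subtype.val ⁻¹' N z : Set ↥(⋃ z, N z)))
    (fun z => (hNo z).preimage continuous_subtype_val)
    (eq_univ_of_forall fun z => by simpa using z.2)
  have hTO : ∀ z ∈ T, z ∈ ⋃ z, N z := fun z hz => mem_iUnion.2 ⟨⟨z, hz⟩, hzN _⟩
  -- transfer to Z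
  obtain ⟨w, hwo, hwN, hwc, hwf⟩ : ∃ w : T → Set Z, (∀ t, IsOpen (w t)) ∧ (∀ t, w t ⊆ N t) ∧
      (∀ z ∈ T, ∃ t, z ∈ w t) ∧ ∀ z ∈ T, {t | z ∈ w t}.Finite := by
    refine ⟨fun t => Subtype.val '' v t, fun t => hOo.isOpenMap_subtype_val _ (hvo t), ?_, ?_, ?_⟩
    · rintro t _ ⟨x, hx, rfl⟩
      exact hvN t hx
    · intro z hz
      have : (⟨z, hTO z hz⟩ : ↥(⋃ z, N z)) ∈ ⋃ i, v i := by rw [hvc]; trivial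
      obtain ⟨t, ht⟩ := mem_iUnion.1 this
      exact ⟨t, _, ht, rfl⟩
    · intro z hz
      refine (hvf.point_finite ⟨z, hTO z hz⟩).subset ?_
      rintro t ⟨x, hx, rfl⟩
      exact hx
  choose S hS1 hS2 using hN
  choose d hd using hS2
  -- the finset of a point
  let F : T → Finset T := fun z => (hwf z z.2).toFinset
  have hF : ∀ (z : T) t, t ∈ F z ↔ (z : Z) ∈ w t := fun z t => by simp [F]
  have hFne : ∀ z, (F z).Nonempty := fun z => by
    obtain ⟨t, ht⟩ := hwc z z.2
    exact ⟨t, (hF z t).2 ht⟩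
  by_cases hT : T.Nonempty
  swap
  · rw [not_nonempty_iff_eq_empty] at hT
    subst hT; exact cds_empty
  have hT' : Nonempty T := hT.to_subtype
  let τ : Finset T → T := fun s => if hs : s.Nonempty then hs.choose else Classical.choice hT'
  have hτ : ∀ s : Finset T, s.Nonempty → τ s ∈ s := fun s hs => by
    simp only [τ, dif_pos hs]; exact hs.choose_spec
  refine cds_of_countable (ι := ℕ × ℕ × ℕ) (fun p =>
    Subtype.val '' {z : T | (F z).card = p.1 ∧ (z : Z) ∈ S (τ (F z)) p.2.1 ∧
      d (τ (F z)) p.2.1 ≤ p.2.2}) ?_ ?_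
  · intro z hz
    have hzz : z ∈ T ∩ N (τ (F ⟨z, hz⟩)) :=
      ⟨hz, hwN _ ((hF ⟨z, hz⟩ _).1 (hτ _ (hFne _)))⟩
    obtain ⟨i, hi⟩ := mem_iUnion.1 (hS1 _ hzz)
    exact mem_iUnion.2 ⟨((F ⟨z, hz⟩).card, i, d (τ (F ⟨z, hz⟩)) i), ⟨z, hz⟩, ⟨rfl, hi, le_rfl⟩, rfl⟩
  · rintro ⟨r, i, e⟩
    refine ⟨2 * e + 1, ?_⟩
    have huniq : ∀ (z : T) (s : Finset T), (F z).card = r → s.card = r →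
        (z : Z) ∈ ⋂ t ∈ s, w t → F z = s := by
      intro z s hz hs hm
      refine (Finset.eq_of_subset_of_card_le (fun t ht => ?_) (by omega)).symm
      rw [hF]
      exact mem_iInter₂.1 hm t ht
    refine dimLE_disjoint (ι := {s : Finset T // s.card = r}) (fun s => ⋂ t ∈ s.1, w t) ?_ ?_ ?_ ?_
    · intro s
      exact isOpen_biInter_finset fun t _ => hwo t
    · rintro _ ⟨z, ⟨h1, -, -⟩, rfl⟩
      exact mem_iUnion.2 ⟨⟨F z, h1⟩, mem_iInter₂.2 fun t ht => (hF _ _).1 ht⟩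
    · rintro _ ⟨z, ⟨h1, -, -⟩, rfl⟩ s s' hs hs'
      exact Subtype.ext ((huniq z s h1 s.2 hs).symm.trans (huniq z s' h1 s'.2 hs'))
    · intro s
      by_cases hse : d (τ s) i ≤ e
      · refine ((hd (τ s) i).mono_n hse).subset ?_
        rintro _ ⟨⟨z, ⟨h1, h2, -⟩, rfl⟩, hs⟩
        rw [huniq z s h1 s.2 hs] at h2
        exact h2
      · convert dimLE_empty _
        rw [eq_empty_iff_forall_notMem]
        rintro _ ⟨⟨z, ⟨h1, -, h2⟩, rfl⟩, hs⟩
        rw [huniq z s h1 s.2 hs] at h2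
        exact hse h2

theorem cp_nhds {X : Type*} [TopologicalSpace X] (Φ : Cp X → ℝ) (hΦ : Continuous Φ) (f : Cp X)
    {ε : ℝ} (hε : 0 < ε) : ∃ F : Set X, F.Finite ∧ ∃ η > 0, ∀ f' : Cp X,
      (∀ x ∈ F, |f'.1 x - f.1 x| < η) → |Φ f' - Φ f| < ε := by
  have h1 : {f' | |Φ f' - Φ f| < ε} ∈ 𝓝 f := by
    have := Metric.tendsto_nhds.1 (hΦ.tendsto f) ε hε
    simp only [Real.dist_eq] at this
    exact this
  have hind : IsInducing (Subtype.val : Cp X → (X → ℝ)) := ⟨rfl⟩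
  replace h1 : _ ∈ 𝓝 f := h1
  erw [hind.nhds_eq_comap, nhds_pi, mem_comap] at h1
  obtain ⟨t, ht, hts⟩ := h1
  obtain ⟨I, hI, s, hs, hst⟩ := mem_pi.1 ht
  have hr : ∀ x, ∃ r > 0, Metric.ball (f.1 x) r ⊆ s x := fun x => Metric.mem_nhds_iff.1 (hs x)
  choose r hr0 hrs using hr
  obtain ⟨η, hη, hηr⟩ : ∃ η > 0, ∀ x ∈ I, η ≤ r x := by
    rcases I.eq_empty_or_nonempty with h | h
    · exact ⟨1, one_pos, by simp [h]⟩
    · obtain ⟨x, hx, hmin⟩ := Set.exists_min_image I r hI h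
      exact ⟨r x, hr0 x, hmin⟩
  refine ⟨I, hI, η, hη, fun f' hf' => hts (hst fun x hx => hrs x ?_)⟩
  rw [Metric.mem_ball, Real.dist_eq]
  exact (hf' x hx).trans_le (hηr x hx)

theorem cutoff {X : Type*} [TopologicalSpace X] [TopologicalSpace.MetrizableSpace X]
    (f f0 : Cp X) {F N : Set X} (hF : F.Finite) (hN : IsOpen N) (hFN : F ⊆ N) :
    ∃ f' : Cp X, (∀ x ∈ F, f'.1 x = f.1 x) ∧ ∀ x ∉ N, f'.1 x = f0.1 x := by
  let _ := TopologicalSpace.metrizableSpaceMetric X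
  obtain ⟨u, hu0, hu1, -⟩ := exists_continuous_zero_one_of_isClosed hN.isClosed_compl hF.isClosed
    (disjoint_compl_left_iff_subset.2 hFN)
  have hf := f.2
  have hf0 := f0.2
  refine ⟨⟨fun x => f0.1 x + u x * (f.1 x - f0.1 x), by fun_prop⟩, fun x hx => ?_, fun x hx => ?_⟩
  · have := hu1 hx
    simp only [Pi.one_apply] at this
    simp [this]
  · have := hu0 hx
    simp only [Pi.zero_apply] at this
    simp [this]

section
variable {X Y : Type*} [TopologicalSpace X] [TopologicalSpace.MetrizableSpace X]
    [TopologicalSpace Y] [TopologicalSpace.MetrizableSpace Y]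

def Works (φ : Cp X → Cp Y) (f0 : Cp X) (δ ε : ℝ) (y : Y) (A : Set X) : Prop :=
  ∀ f : Cp X, (∀ x ∈ A, |f.1 x - f0.1 x| < δ) → |(φ f).1 y - (φ f0).1 y| ≤ ε

def Ym (φ : Cp X → Cp Y) (f0 : Cp X) (δ ε : ℝ) (m : ℕ) : Set Y :=
  {y | (∃ A : Fin m → X, Works φ f0 δ ε y (range A)) ∧
    ∀ k < m, ∀ A : Fin k → X, ¬ Works φ f0 δ ε y (range A)}

def KK (φ : Cp X → Cp Y) (f0 : Cp X) (δ ε : ℝ) (m : ℕ) (y : Y) (x : X) : Prop :=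
  ∃ A : Fin m → X, Works φ f0 δ ε y (range A) ∧ x ∈ range A

theorem ym_min {φ : Cp X → Cp Y} {f0 : Cp X} {δ ε : ℝ} {m : ℕ} {y : Y}
    (hy : y ∈ Ym φ f0 δ ε m) {R : Set X} (hR : R.Finite) (hw : Works φ f0 δ ε y R) :
    m ≤ R.ncard := by
  by_contra hlt
  have := hR.to_subtype
  have e : Fin R.ncard ≃ R := (Finite.equivFin R).symm
  refine hy.2 R.ncard (not_le.1 hlt) (fun i => (e i : X)) ?_
  have : range (fun i => (e i : X)) = R := by
    rw [show (fun i => (e i : X)) = Subtype.val ∘ e from rfl, e.surjective.range_comp]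
    simp
  rwa [this]

theorem cont_eval {φ : Cp X → Cp Y} (hφ : Continuous φ) (y : Y) :
    Continuous fun f => (φ f).1 y :=
  (continuous_apply y).comp (continuous_subtype_val.comp hφ)

/-- A set of `j` such that all those limits work gives everything. -/
theorem partial_all {φ : Cp X → Cp Y} {f0 : Cp X} {δ ε : ℝ} {m : ℕ} {y : Y}
    (hy : y ∈ Ym φ f0 δ ε m) (J : Set (Fin m)) (a : Fin m → X)
    (hw : Works φ f0 δ ε y (a '' J)) : J = univ := by
  have h1 := ym_min hy ((toFinite J).image a) hw
  have h2 := ncard_image_le (f := a) (toFinite J)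
  refine eq_of_subset_of_ncard_le (subset_univ _) ?_ (toFinite _)
  rw [ncard_univ, Nat.card_fin]
  omega

theorem usc_tuple {φ : Cp X → Cp Y} (hφ : Continuous φ) {f0 : Cp X} {δ ε : ℝ} (hδ : 0 < δ)
    {m : ℕ} {I : Type*} (𝒰 : Ultrafilter I) (y : I → Y) (A : I → Fin m → X)
    (hw : ∀ᶠ i in (𝒰 : Filter I), Works φ f0 δ ε (y i) (range (A i))) {y0 : Y}
    (hy : Tendsto y 𝒰 (𝓝 y0)) (hy0 : y0 ∈ Ym φ f0 δ ε m) :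
    ∃ a : Fin m → X, (∀ j, Tendsto (fun i => A i j) 𝒰 (𝓝 (a j))) ∧
      Works φ f0 δ ε y0 (range a) := by
  classical
  obtain ⟨A0, hA0⟩ := hy0.1
  set J : Set (Fin m) := {j | ∃ p, Tendsto (fun i => A i j) 𝒰 (𝓝 p)} with hJ
  let a : Fin m → X := fun j => if h : ∃ p, Tendsto (fun i => A i j) 𝒰 (𝓝 p) then h.choose else A0 j
  have ha : ∀ j ∈ J, Tendsto (fun i => A i j) 𝒰 (𝓝 (a j)) := by
    intro j hj
    have hj' : ∃ p, Tendsto (fun i => A i j) 𝒰 (𝓝 p) := hj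
    simp only [a, dif_pos hj']
    exact hj'.choose_spec
  have hwork : Works φ f0 δ ε y0 (a '' J) := by
    intro f hf
    refine le_of_forall_pos_le_add fun η hη => ?_
    obtain ⟨F, hF, η', hη', hFf⟩ := cp_nhds (fun f => (φ f).1 y0) (cont_eval hφ y0) f hη
    have hFR : (F ∪ a '' J).Finite := hF.union ((toFinite J).image a)
    have hnb : ∀ p : X, ∃ N, IsOpen N ∧ p ∈ N ∧ ∀ j ∉ J, ∀ᶠ i in (𝒰 : Filter I), A i j ∉ N := by
      intro p
      have h1 : ∀ j, ∃ N, IsOpen N ∧ p ∈ N ∧ (j ∉ J → ∀ᶠ i in (𝒰 : Filter I), A i j ∉ N) := by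
        intro j
        by_cases hj : j ∈ J
        · exact ⟨univ, isOpen_univ, trivial, fun h => (h hj).elim⟩
        · have hnt : ¬ Tendsto (fun i => A i j) 𝒰 (𝓝 p) := fun h => hj ⟨p, h⟩
          rw [tendsto_nhds] at hnt
          push Not at hnt
          obtain ⟨N, hN, hp, hN'⟩ := hnt
          exact ⟨N, hN, hp, fun _ => Ultrafilter.compl_mem_iff_notMem.2 hN'⟩
      choose N hN hp hN' using h1
      refine ⟨⋂ j, N j, isOpen_iInter_of_finite hN, mem_iInter.2 hp, fun j hj => ?_⟩
      filter_upwards [hN' j hj] with i hi hmem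
      exact hi (mem_iInter.1 hmem j)
    choose N hN hpN hNJ using hnb
    obtain ⟨f', hf'1, hf'2⟩ := cutoff f f0 hFR
      (isOpen_biUnion fun p (_ : p ∈ F ∪ a '' J) => hN p)
      (fun p hp => mem_iUnion₂.2 ⟨p, hp, hpN p⟩)
    have hev : ∀ᶠ i in (𝒰 : Filter I), ∀ j, |f'.1 (A i j) - f0.1 (A i j)| < δ := by
      rw [eventually_all]
      intro j
      by_cases hj : j ∈ J
      · have hc : Continuous fun x => |f'.1 x - f0.1 x| := (f'.2.sub f0.2).abs
        refine ((hc.tendsto _).comp (ha j hj)).eventually_lt_const ?_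
        rw [hf'1 _ (Or.inr ⟨j, hj, rfl⟩)]
        exact hf _ ⟨j, hj, rfl⟩
      · have : ∀ᶠ i in (𝒰 : Filter I), ∀ p ∈ F ∪ a '' J, A i j ∉ N p :=
          (eventually_all_finite hFR).2 fun p _ => hNJ p j hj
        filter_upwards [this] with i hi
        rw [hf'2 _ (by simpa only [mem_iUnion₂, not_exists] using hi)]
        simpa using hδ
    have hle : ∀ᶠ i in (𝒰 : Filter I), |(φ f').1 (y i) - (φ f0).1 (y i)| ≤ ε := by
      filter_upwards [hw, hev] with i hi hi'
      refine hi f' ?_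
      rintro _ ⟨j, rfl⟩
      exact hi' j
    have hlim : |(φ f').1 y0 - (φ f0).1 y0| ≤ ε := by
      have hc : Continuous fun z => |(φ f').1 z - (φ f0).1 z| := ((φ f').2.sub (φ f0).2).abs
      exact le_of_tendsto ((hc.tendsto y0).comp hy) hle
    have h3 := hFf f' (fun x hx => by rw [hf'1 x (Or.inl hx)]; simpa using hη')
    have h4 := abs_sub_abs_le_abs_sub ((φ f).1 y0 - (φ f0).1 y0) ((φ f').1 y0 - (φ f0).1 y0)
    rw [sub_sub_sub_cancel_right, abs_sub_comm ((φ f).1 y0) ((φ f').1 y0)] at h4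
    linarith
  have hall := partial_all hy0 J a hwork
  refine ⟨a, fun j => ha j (by rw [hall]; trivial), ?_⟩
  rwa [hall, image_univ] at hwork

theorem fin_tuple {φ : Cp X → Cp Y} (hφ : Continuous φ) {f0 : Cp X} {δ ε : ℝ} (hδ : 0 < δ)
    {m : ℕ} {y0 : Y} (hy0 : y0 ∈ Ym φ f0 δ ε m) :
    {A : Fin m → X | Works φ f0 δ ε y0 (range A)}.Finite := by
  classical
  by_contra hinf
  set T := {A : Fin m → X | Works φ f0 δ ε y0 (range A)} with hT
  have : Infinite T := Set.infinite_coe_iff.2 hinf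
  obtain ⟨A0, hA0⟩ := hy0.1
  let 𝒰 := hyperfilter T
  set J : Set (Fin m) := {j | ∃ p, ∀ᶠ A in (𝒰 : Filter T), A.1 j = p} with hJ
  let a : Fin m → X := fun j =>
    if h : ∃ p, ∀ᶠ A in (𝒰 : Filter T), A.1 j = p then h.choose else A0 j
  have ha : ∀ j ∈ J, ∀ᶠ A in (𝒰 : Filter T), A.1 j = a j := by
    intro j hj
    have hj' : ∃ p, ∀ᶠ A in (𝒰 : Filter T), A.1 j = p := hj
    simp only [a, dif_pos hj']
    exact hj'.choose_spec
  have hwork : Works φ f0 δ ε y0 (a '' J) := by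
    intro f hf
    refine le_of_forall_pos_le_add fun η hη => ?_
    obtain ⟨F, hF, η', hη', hFf⟩ := cp_nhds (fun f => (φ f).1 y0) (cont_eval hφ y0) f hη
    have hFR : (F ∪ a '' J).Finite := hF.union ((toFinite J).image a)
    have hev : ∀ᶠ A in (𝒰 : Filter T), ∀ j, (j ∈ J → A.1 j = a j) ∧
        (j ∉ J → ∀ p ∈ F ∪ a '' J, A.1 j ≠ p) := by
      rw [eventually_all]
      intro j
      by_cases hj : j ∈ J
      · filter_upwards [ha j hj] with A hA
        exact ⟨fun _ => hA, fun h => (h hj).elim⟩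
      · have : ∀ᶠ A in (𝒰 : Filter T), ∀ p ∈ F ∪ a '' J, A.1 j ≠ p := by
          refine (eventually_all_finite hFR).2 fun p _ => ?_
          exact Ultrafilter.eventually_not.2 fun h => hj ⟨p, h⟩
        filter_upwards [this] with A hA
        exact ⟨fun h => (hj h).elim, fun _ => hA⟩
    obtain ⟨A, hA⟩ := hev.exists
    obtain ⟨f', hf'1, hf'2⟩ := cutoff f f0 hFR (N := (A.1 '' Jᶜ)ᶜ)
      ((toFinite Jᶜ).image _).isClosed.isOpen_compl
      (by
        rintro p hp ⟨j, hj, hjp⟩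
        exact (hA j).2 hj p hp hjp)
    have hlim : |(φ f').1 y0 - (φ f0).1 y0| ≤ ε := by
      refine A.2 f' ?_
      rintro _ ⟨j, rfl⟩
      by_cases hj : j ∈ J
      · rw [(hA j).1 hj, hf'1 _ (Or.inr ⟨j, hj, rfl⟩)]
        exact hf _ ⟨j, hj, rfl⟩
      · rw [hf'2 _ (fun h => h ⟨j, hj, rfl⟩)]
        simpa using hδ
    have h3 := hFf f' (fun x hx => by rw [hf'1 x (Or.inl hx)]; simpa using hη')
    have h4 := abs_sub_abs_le_abs_sub ((φ f).1 y0 - (φ f0).1 y0) ((φ f').1 y0 - (φ f0).1 y0)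
    rw [sub_sub_sub_cancel_right, abs_sub_comm ((φ f).1 y0) ((φ f').1 y0)] at h4
    linarith
  have hall := partial_all hy0 J a hwork
  have hev : ∀ᶠ A in (𝒰 : Filter T), ∀ j, A.1 j = a j := by
    rw [eventually_all]
    intro j
    exact ha j (by rw [hall]; trivial)
  refine Set.Finite.notMem_hyperfilter (α := T) (s := {A : T | ∀ j, A.1 j = a j}) ?_ hev
  refine Set.Subsingleton.finite ?_
  intro A hA B hB
  exact Subtype.ext (funext fun j => (hA j).trans (hB j).symm)

theorem fin_KK {φ : Cp X → Cp Y} (hφ : Continuous φ) {f0 : Cp X} {δ ε : ℝ} (hδ : 0 < δ)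
    {m : ℕ} {y0 : Y} (hy0 : y0 ∈ Ym φ f0 δ ε m) : {x | KK φ f0 δ ε m y0 x}.Finite := by
  refine ((fin_tuple hφ hδ hy0).biUnion fun A _ => finite_range A).subset ?_
  rintro x ⟨A, hA, hx⟩
  exact mem_iUnion₂.2 ⟨A, hA, hx⟩

theorem usc_KK {φ : Cp X → Cp Y} (hφ : Continuous φ) {f0 : Cp X} {δ ε : ℝ} (hδ : 0 < δ)
    {m : ℕ} (𝒰 : Ultrafilter (Y × X)) (y0 : Y) (hy0 : y0 ∈ Ym φ f0 δ ε m)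
    (hK : ∀ᶠ p in (𝒰 : Filter (Y × X)), KK φ f0 δ ε m p.1 p.2)
    (hy : Tendsto Prod.fst (𝒰 : Filter (Y × X)) (𝓝 y0)) :
    ∃ x0, KK φ f0 δ ε m y0 x0 ∧ Tendsto Prod.snd (𝒰 : Filter (Y × X)) (𝓝 x0) := by
  classical
  obtain ⟨A0, hA0⟩ := hy0.1
  have hex : ∀ p : Y × X, ∃ A : Fin m → X, KK φ f0 δ ε m p.1 p.2 →
      Works φ f0 δ ε p.1 (range A) ∧ p.2 ∈ range A := by
    intro p
    by_cases h : KK φ f0 δ ε m p.1 p.2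
    · obtain ⟨A, hA⟩ := h
      exact ⟨A, fun _ => hA⟩
    · exact ⟨A0, fun h' => (h h').elim⟩
  choose A hA using hex
  obtain ⟨a, ha, haw⟩ := usc_tuple hφ hδ 𝒰 Prod.fst A (hK.mono fun p hp => (hA p hp).1) hy hy0
  have h1 : ∀ᶠ p in (𝒰 : Filter (Y × X)), ∃ j, A p j = p.2 := hK.mono fun p hp => (hA p hp).2
  rw [Ultrafilter.eventually_exists_iff] at h1
  obtain ⟨j, hj⟩ := h1
  exact ⟨a j, ⟨a, haw, mem_range_self j⟩, (ha j).congr' hj⟩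

theorem exists_ym {φ : Cp X → Cp Y} (hφ : Continuous φ) (f0 : Cp X) {ε : ℝ} (hε : 0 < ε)
    (y : Y) : ∃ k m : ℕ, y ∈ Ym φ f0 (1 / ((k : ℝ) + 1)) ε m := by
  classical
  obtain ⟨F, hF, η, hη, h⟩ := cp_nhds (fun f => (φ f).1 y) (cont_eval hφ y) f0 hε
  obtain ⟨k, hk⟩ := exists_nat_one_div_lt hη
  have hex : ∃ m, ∃ A : Fin m → X, Works φ f0 (1 / ((k : ℝ) + 1)) ε y (range A) := by
    obtain ⟨m, u, hu⟩ := hF.fin_embedding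
    refine ⟨m, u, fun f hf => (h f fun x hx => ?_).le⟩
    exact (hf x (by rw [hu]; exact hx)).trans hk
  exact ⟨k, Nat.find hex, Nat.find_spec hex, fun k' hk' A hA => Nat.find_min hex hk' ⟨A, hA⟩⟩

theorem back_forth (φ : Cp X ≃ₜ Cp Y) (f0 : Cp X) {δ ε δ' : ℝ} (hδ' : δ' < δ)
    {y : Y} {A : Set X} (hA : A.Finite) (hw : Works φ f0 δ ε y A)
    (B : X → Set Y) (r : X → ℝ) (hr : ∀ x, 0 < r x) (hBf : ∀ x ∈ A, (B x).Finite)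
    (hB : ∀ x ∈ A, Works φ.symm (φ f0) (r x) δ' x (B x)) : ∃ x ∈ A, y ∈ B x := by
  by_contra hcon
  push Not at hcon
  have hfin : (⋃ x ∈ A, B x).Finite := hA.biUnion hBf
  have hg0 := (φ f0).2
  obtain ⟨g, hg1, hg2⟩ := cutoff (⟨fun z => (φ f0).1 z + (|ε| + 1), by fun_prop⟩ : Cp Y) (φ f0)
    (finite_singleton y) hfin.isClosed.isOpen_compl
    (by
      rintro _ rfl h
      obtain ⟨x, hx, hy⟩ := mem_iUnion₂.1 h
      exact hcon x hx hy)
  have h1 := hw (φ.symm g) (fun x hx => by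
    have := hB x hx g (fun z hz => by
      rw [hg2 z (fun h => h (mem_iUnion₂.2 ⟨x, hx, hz⟩))]
      simpa using hr x)
    rw [φ.symm_apply_apply] at this
    exact this.trans_lt hδ')
  rw [φ.apply_symm_apply, hg1 y rfl] at h1
  simp only [add_sub_cancel_left] at h1
  rw [abs_of_nonneg (by positivity)] at h1
  linarith [le_abs_self ε]

theorem iso_aux {Z : Type*} [MetricSpace Z] {S : Set Z} (hS : S.Finite) (z : Z) :
    ∀ᶠ n : ℕ in atTop, ∀ z' ∈ S, dist z' z ≤ 1 / ((n : ℝ) + 1) → z' = z := by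
  refine (eventually_all_finite hS).2 fun z' _ => ?_
  by_cases h : z' = z
  · exact Eventually.of_forall fun _ _ => h
  · filter_upwards [(tendsto_one_div_add_atTop_nhds_zero_nat (𝕜 := ℝ)).eventually_lt_const
      (dist_pos.2 h)] with n hn hle
    linarith

/-- the abstract decomposition lemma -/
theorem cds_abs (hX : CDS (univ : Set X)) (Ys : Set Y) (Xs : Set X) (K : Y → X → Prop)
    (K' : X → Y → Prop) (hKf : ∀ y ∈ Ys, {x | K y x}.Finite) (hKf' : ∀ x ∈ Xs, {y | K' x y}.Finite)
    (hK : ∀ (𝒰 : Ultrafilter (Y × X)), ∀ y0 ∈ Ys, (∀ᶠ p in (𝒰 : Filter (Y × X)), K p.1 p.2) →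
      Tendsto Prod.fst (𝒰 : Filter (Y × X)) (𝓝 y0) →
      ∃ x0, K y0 x0 ∧ Tendsto Prod.snd (𝒰 : Filter (Y × X)) (𝓝 x0))
    (hK' : ∀ (𝒰 : Ultrafilter (X × Y)), ∀ x0 ∈ Xs, (∀ᶠ p in (𝒰 : Filter (X × Y)), K' p.1 p.2) →
      Tendsto Prod.fst (𝒰 : Filter (X × Y)) (𝓝 x0) →
      ∃ y0, K' x0 y0 ∧ Tendsto Prod.snd (𝒰 : Filter (X × Y)) (𝓝 y0)) :
    CDS {y | y ∈ Ys ∧ ∃ x ∈ Xs, K y x ∧ K' x y} := by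
  classical
  let _ := TopologicalSpace.metrizableSpaceMetric X
  let _ := TopologicalSpace.metrizableSpaceMetric Y
  -- isolated at scale e
  let Q : ℝ → Y → X → Prop := fun e y x => x ∈ Xs ∧ K y x ∧ K' x y ∧
    (∀ x', K y x' → dist x' x ≤ e → x' = x) ∧ (∀ y', K' x y' → dist y' y ≤ e → y' = y)
  have hmono : {y | y ∈ Ys ∧ ∃ x ∈ Xs, K y x ∧ K' x y} ⊆
      ⋃ n : ℕ, {y | y ∈ Ys ∧ ∃ x, Q (1 / ((n : ℝ) + 1)) y x} := by
    rintro y ⟨hy, x, hx, h1, h2⟩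
    obtain ⟨n, hn1, hn2⟩ := ((iso_aux (hKf y hy) x).and (iso_aux (hKf' x hx) y)).exists
    exact mem_iUnion.2 ⟨n, hy, x, hx, h1, h2, hn1, hn2⟩
  refine CDS.mono (cds_iUnion fun n => ?_) hmono
  have he : (0 : ℝ) < 1 / ((n : ℝ) + 1) := by positivity
  set e : ℝ := 1 / ((n : ℝ) + 1)
  refine cds_local ?_
  rintro y0 ⟨hy0, -⟩
  set C := {x | K y0 x} with hC
  have hCf : C.Finite := hKf y0 hy0
  obtain ⟨N, hN, hyN, hNK⟩ : ∃ N, IsOpen N ∧ y0 ∈ N ∧ ∀ y ∈ N, ∀ x, K y x →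
      x ∈ ⋃ c ∈ C, Metric.ball c (e / 4) := by
    set O := ⋃ c ∈ C, Metric.ball c (e / 4) with hO
    have hOo : IsOpen O := isOpen_biUnion fun c _ => Metric.isOpen_ball
    set B : Set (Y × X) := {p | K p.1 p.2 ∧ p.2 ∉ O} with hB
    have hbot : comap Prod.fst (𝓝 y0) ⊓ 𝓟 B = ⊥ := by
      by_contra hne
      have : NeBot (comap Prod.fst (𝓝 y0) ⊓ 𝓟 B) := ⟨hne⟩
      have hle := Ultrafilter.of_le (comap Prod.fst (𝓝 y0) ⊓ 𝓟 B)
      set 𝒰 := Ultrafilter.of (comap Prod.fst (𝓝 y0) ⊓ 𝓟 B)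
      have hBm : ∀ᶠ p in (𝒰 : Filter (Y × X)), p ∈ B := le_principal_iff.1 (hle.trans inf_le_right)
      obtain ⟨x0, hx0, hlim⟩ := hK 𝒰 y0 hy0 (hBm.mono fun p hp => hp.1)
        (tendsto_iff_comap.2 (hle.trans inf_le_left))
      have hx0O : x0 ∈ O := mem_iUnion₂.2 ⟨x0, hx0, Metric.mem_ball_self (by positivity)⟩
      obtain ⟨p, hp1, hp2⟩ := ((hlim.eventually (hOo.mem_nhds hx0O)).and hBm).exists
      exact hp2.2 hp1
    rw [inf_principal_eq_bot, mem_comap] at hbot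
    obtain ⟨t, ht, htB⟩ := hbot
    refine ⟨interior t, isOpen_interior, mem_interior_iff_mem_nhds.2 ht, fun y hy x hx => ?_⟩
    by_contra hxO
    have hyt : y ∈ t := interior_subset hy
    have : (y, x) ∈ Prod.fst ⁻¹' t := hyt
    exact htB this ⟨hx, hxO⟩
  refine ⟨N ∩ Metric.ball y0 (e / 4), hN.inter Metric.isOpen_ball,
    ⟨hyN, Metric.mem_ball_self (by positivity)⟩, ?_⟩
  have hcount : Countable C := hCf.countable.to_subtype
  refine CDS.mono (cds_iUnion (M := fun c : C => {y | y ∈ Ys ∧ y ∈ Metric.ball y0 (e / 4) ∧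
    ∃ x ∈ Metric.ball c.1 (e / 4), Q e y x}) ?_) ?_
  swap
  · rintro y ⟨⟨hy, x, hx⟩, hyN, hyb⟩
    obtain ⟨c, hc, hxc⟩ := mem_iUnion₂.1 (hNK y hyN x hx.2.1)
    exact mem_iUnion.2 ⟨⟨c, hc⟩, hy, hyb, x, hxc, hx⟩
  rintro ⟨c, hc⟩
  simp only
  set P := {y | y ∈ Ys ∧ y ∈ Metric.ball y0 (e / 4) ∧ ∃ x ∈ Metric.ball c (e / 4), Q e y x} with hP
  choose a hab haQ using fun y : P => y.2.2.2
  refine cds_transfer hX (f := a) ?_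
  rw [isInducing_iff_nhds]
  intro p
  refine le_antisymm (le_iff_ultrafilter.2 fun g hg => ?_) (le_iff_ultrafilter.2 fun g hg => ?_)
  · rw [← tendsto_iff_comap]
    have hval : Tendsto (fun q : P => (q : Y)) (g : Filter P) (𝓝 (p : Y)) :=
      (continuous_subtype_val.tendsto p).mono_left hg
    obtain ⟨x0, hx0, hlim⟩ := hK (g.map fun q : P => ((q : Y), a q)) p p.2.1
      (by
        rw [Ultrafilter.coe_map, eventually_map]
        exact Eventually.of_forall fun q => (haQ q).2.1)
      (by rw [Ultrafilter.coe_map, tendsto_map'_iff]; exact hval)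
    rw [Ultrafilter.coe_map, tendsto_map'_iff] at hlim
    have hlim' : Tendsto a (g : Filter P) (𝓝 x0) := hlim
    have hd : dist x0 c ≤ e / 4 :=
      le_of_tendsto (hlim'.dist tendsto_const_nhds)
        (Eventually.of_forall fun q => (Metric.mem_ball.1 (hab q)).le)
    have hd2 := Metric.mem_ball'.1 (hab p)
    have hd3 := dist_triangle x0 c (a p)
    rw [← (haQ p).2.2.2.1 x0 hx0 (by linarith)]
    exact hlim'
  · rw [← tendsto_iff_comap] at hg
    obtain ⟨y1, hy1, hlim⟩ := hK' (g.map fun q : P => (a q, (q : Y))) (a p) (haQ p).1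
      (by
        rw [Ultrafilter.coe_map, eventually_map]
        exact Eventually.of_forall fun q => (haQ q).2.2.1)
      (by rw [Ultrafilter.coe_map, tendsto_map'_iff]; exact hg)
    rw [Ultrafilter.coe_map, tendsto_map'_iff] at hlim
    have hlim' : Tendsto (fun q : P => (q : Y)) (g : Filter P) (𝓝 y1) := hlim
    have hd : dist y1 y0 ≤ e / 4 :=
      le_of_tendsto (hlim'.dist tendsto_const_nhds)
        (Eventually.of_forall fun q => (Metric.mem_ball.1 q.2.2.1).le)
    have hd2 := Metric.mem_ball'.1 p.2.2.1
    have hd3 := dist_triangle y1 y0 p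
    have := (haQ p).2.2.2.2 y1 hy1 (by linarith)
    rw [this] at hlim'
    rw [nhds_subtype_eq_comap, ← tendsto_iff_comap]
    exact hlim'

theorem one_dir (φ : Cp X ≃ₜ Cp Y) (hX : CountableDimensional X) : CountableDimensional Y := by
  rw [cd_iff] at hX ⊢
  let f0 : Cp X := ⟨fun _ => 0, continuous_const⟩
  have hpos : ∀ k : ℕ, (0 : ℝ) < 1 / ((k : ℝ) + 1) := fun k => by positivity
  refine CDS.mono (cds_iUnion (ι := (ℕ × ℕ) × (ℕ × ℕ)) (M := fun q =>
    {y | y ∈ Ym φ f0 (1 / ((q.1.1 : ℝ) + 1)) 1 q.1.2 ∧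
      ∃ x ∈ Ym φ.symm (φ f0) (1 / ((q.2.1 : ℝ) + 1)) (1 / ((q.1.1 : ℝ) + 1) / 2) q.2.2,
        KK φ f0 (1 / ((q.1.1 : ℝ) + 1)) 1 q.1.2 y x ∧
        KK φ.symm (φ f0) (1 / ((q.2.1 : ℝ) + 1)) (1 / ((q.1.1 : ℝ) + 1) / 2) q.2.2 x y}) ?_) ?_
  · rintro ⟨⟨k, m⟩, ⟨k', m'⟩⟩
    exact cds_abs hX _ _ _ _ (fun y hy => fin_KK φ.continuous (hpos k) hy)
      (fun x hx => fin_KK φ.symm.continuous (hpos k') hx)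
      (fun 𝒰 y0 hy0 => usc_KK φ.continuous (hpos k) 𝒰 y0 hy0)
      (fun 𝒰 x0 hx0 => usc_KK φ.symm.continuous (hpos k') 𝒰 x0 hx0)
  · intro y _
    obtain ⟨k, m, hy⟩ := exists_ym φ.continuous f0 one_pos y
    obtain ⟨A, hA⟩ := hy.1
    choose k' m' hx using fun x : X =>
      exists_ym φ.symm.continuous (φ f0) (half_pos (hpos k)) x
    choose B hB using fun x => (hx x).1
    obtain ⟨x, hxA, hyB⟩ := back_forth φ f0 (half_lt_self (hpos k)) (finite_range A) hA
      (fun x => range (B x)) (fun x => 1 / ((k' x : ℝ) + 1)) (fun x => hpos _)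
      (fun x _ => finite_range _) (fun x _ => hB x)
    exact mem_iUnion.2 ⟨((k, m), (k' x, m' x)), hy, x, hx x, ⟨A, hA, hxA⟩, ⟨B x, hB x, hyB⟩⟩

end

end TInv

/-- Marciszewski's theorem: if `X` and `Y` are t-equivalent metrizable spaces, i.e.
`C_p(X)` and `C_p(Y)` are homeomorphic, then `X` is countable-dimensional iff `Y` is. -/
theorem countable_dimensional_t_invariant {X Y : Type*}
    [TopologicalSpace X] [TopologicalSpace.MetrizableSpace X]
    [TopologicalSpace Y] [TopologicalSpace.MetrizableSpace Y]
    (h : Nonempty (Cp X ≃ₜ Cp Y)) :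
    CountableDimensional X ↔ CountableDimensional Y := by
  obtain ⟨φ⟩ := h
  exact ⟨TInv.one_dir φ, TInv.one_dir φ.symm⟩
end

section
/- For every integer n ≥ 1 there exists a perfect continuous surjection from the cube [0,1]^n onto the Hilbert cube [0,1]^ℕ; that is, a continuous surjection f : [0,1]^n → [0,1]^ℕ that is a closed map and all of whose fibers are compact. -/
/-- For every `n ≥ 1` there is a perfect continuous surjection from the cube `[0,1]^n`
onto the Hilbert cube `[0,1]^ℕ`: a continuous surjection which is a closed map and all
of whose fibers are compact. -/
theorem exists_perfect_surjection_cube_to_hilbert_cube (n : ℕ) (hn : 1 ≤ n) :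
    ∃ f : (Fin n → unitInterval) → (ℕ → unitInterval),
      Continuous f ∧ Function.Surjective f ∧ IsClosedMap f ∧
        ∀ b, IsCompact (f ⁻¹' {b}) := by
  let e : (ℕ → Bool) → ℝ := fun x => (cantorSetHomeomorphNatToBool.symm x : ℝ)
  have he : Topology.IsClosedEmbedding e :=
    (isClosed_cantorSet.isClosedEmbedding_subtypeVal).comp
      cantorSetHomeomorphNatToBool.symm.isClosedEmbedding
  have hI : ∀ x, e x ∈ unitInterval := fun x =>
    cantorSet_subset_unitInterval (cantorSetHomeomorphNatToBool.symm x).2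
  haveI : TietzeExtension unitInterval := inferInstanceAs (TietzeExtension (Set.Icc (0:ℝ) 1))
  obtain ⟨g, hg⟩ := ContinuousMap.exists_extension he
    (⟨cantorToHilbert, cantorToHilbert_continuous⟩ : C(ℕ → Bool, ℕ → unitInterval))
  have hc : Continuous (fun x : Fin n → unitInterval => g (x ⟨0, hn⟩ : ℝ)) := by fun_prop
  refine ⟨_, hc, ?_, hc.isClosedMap, fun b => (isClosed_singleton.preimage hc).isCompact⟩
  intro b
  obtain ⟨c, rfl⟩ := cantorToHilbert_surjective b
  exact ⟨fun _ => ⟨e c, hI c⟩, DFunLike.congr_fun hg c⟩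
end
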